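/- arXiv:2208.07266 — 2 statements merged into one kernel-verified Lean document; each statement's English description precedes it below -/
import Mathlib

section
/- Let ℓ, k, r, q be integers with ℓ ≥ 1, k ≥ 1, r ≥ 2, q ≥ 2, let A = (a₁ ≥ a₂ ≥ ⋯ ≥ a_r ≥ 1) and B = (b₁ ≥ b₂ ≥ ⋯ ≥ b_q ≥ 1) be partitions of ℓ with a₁ + b₁ ≤ k. Then the sets R^ℓ_{A,B} and S^ℓ_{A,B} have the same (finite) cardinality: |R^ℓ_{A,B}| = |S^ℓ_{A,B}|. -/
/-- `StepSet τ j σ` : σ is obtained from the partition (Young diagram) τ by decreasing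
exactly `j` distinct parts of τ by 1; equivalently `|σ| + j = |τ|` and
`τᵢ - 1 ≤ σᵢ ≤ τᵢ` for every row `i`.  This is the set `S^τ_j` of the paper. -/
def StepSet (τ : YoungDiagram) (j : ℕ) (σ : YoungDiagram) : Prop :=
  σ.card + j = τ.card ∧ ∀ i, σ.rowLen i ≤ τ.rowLen i ∧ τ.rowLen i ≤ σ.rowLen i + 1

/-- The Young diagram is a single column `(1,1,…,1)` with `m` parts equal to 1. -/
def IsColumn (m : ℕ) (σ : YoungDiagram) : Prop :=
  ∀ i, σ.rowLen i = if i < m then 1 else 0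

/-- `T` is a standard Young tableau of shape `μ`: entries strictly increase along
rows and down columns, vanish outside `μ`, and the entries on the cells of `μ`
are exactly `1, …, μ.card`, each used exactly once. -/
def IsSYT (μ : YoungDiagram) (T : ℕ → ℕ → ℕ) : Prop :=
  (∀ i j1 j2, j1 < j2 → (i, j2) ∈ μ → T i j1 < T i j2) ∧
  (∀ i1 i2 j, i1 < i2 → (i2, j) ∈ μ → T i1 j < T i2 j) ∧
  (∀ i j, (i, j) ∉ μ → T i j = 0) ∧
  μ.cells.image (fun c => T c.1 c.2) = Finset.Icc 1 μ.card ∧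
  Set.InjOn (fun c : ℕ × ℕ => T c.1 c.2) ↑μ.cells

/-- The `j`-th (0-indexed) block of `[ℓ] = {1, …, ℓ}` determined by a partition `A`:
`Block A j = {A 0 + ⋯ + A (j-1) + 1, …, A 0 + ⋯ + A j}`. -/
def Block (A : ℕ → ℕ) (j : ℕ) : Finset ℕ :=
  Finset.Ioc (∑ i ∈ Finset.range j, A i) (∑ i ∈ Finset.range (j + 1), A i)

/-- For each block `Block A j` (`j < r`), entries of the block occur in strictly
increasing rows of the tableau `T` of shape `μ`. -/
def BlockRowCond (r : ℕ) (A : ℕ → ℕ) (μ : YoungDiagram) (T : ℕ → ℕ → ℕ) : Prop :=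
  ∀ j < r, ∀ m₁ ∈ Block A j, ∀ m₂ ∈ Block A j, m₁ < m₂ →
    ∀ c₁ ∈ μ.cells, ∀ c₂ ∈ μ.cells, T c₁.1 c₁.2 = m₁ → T c₂.1 c₂.2 = m₂ → c₁.1 < c₂.1

/-- The set `R^ℓ_{A,B}` of the paper, encoded as triples `(P, Q, τ)` where the
sequences `P` and `Q` are 0-indexed (so `P 0` is the paper's `P₁`, etc.). -/
def RSet (ℓ k r q : ℕ) (A B : ℕ → ℕ) :
    Set ((Fin (r - 1) → YoungDiagram) × (Fin (q - 1) → YoungDiagram) × YoungDiagram) :=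
  {x | x.2.2.card = ℓ ∧ x.2.2.colLen 0 ≤ k ∧ x.2.2.rowLen 0 ≤ min r q ∧
    (∀ i : Fin (r - 1), (i : ℕ) = 0 → StepSet x.2.2 (A 0) (x.1 i)) ∧
    (∀ i i' : Fin (r - 1), (i' : ℕ) = (i : ℕ) + 1 →
      StepSet (x.1 i) (A (i' : ℕ)) (x.1 i')) ∧
    (∀ i : Fin (r - 1), (i : ℕ) = r - 2 → IsColumn (A (r - 1)) (x.1 i)) ∧
    (∀ i : Fin (q - 1), (i : ℕ) = 0 → StepSet x.2.2 (B 0) (x.2.1 i)) ∧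
    (∀ i i' : Fin (q - 1), (i' : ℕ) = (i : ℕ) + 1 →
      StepSet (x.2.1 i) (B (i' : ℕ)) (x.2.1 i')) ∧
    (∀ i : Fin (q - 1), (i : ℕ) = q - 2 → IsColumn (B (q - 1)) (x.2.1 i))}

/-- The set `S^ℓ_{A,B}` of the paper: pairs `(M, N)` of standard Young tableaux of the
same shape `μ` with `ℓ` boxes, at most `k` rows, first row of length at most `min r q`,
`M` satisfying the row condition for the blocks `U_j` of `A`,
and `N` satisfying the row condition for the blocks `V_j` of `B`. -/
def SYTPairSet (ℓ k r q : ℕ) (A B : ℕ → ℕ) :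
    Set (YoungDiagram × (ℕ → ℕ → ℕ) × (ℕ → ℕ → ℕ)) :=
  {x | x.1.card = ℓ ∧ x.1.colLen 0 ≤ k ∧ x.1.rowLen 0 ≤ min r q ∧
    IsSYT x.1 x.2.1 ∧ IsSYT x.1 x.2.2 ∧
    BlockRowCond r A x.1 x.2.1 ∧ BlockRowCond q B x.1 x.2.2}

/-- The set `W^ℓ_{A,B}` of the paper: permutations `w` of `[ℓ] = {1, …, ℓ}` (extended by
the identity off `[ℓ]`) with no decreasing subsequence of length `k + 1`, such that for
`j₁ < j₂` in a common block `U_j` of `A`, `j₂` occurs in an earlier position than `j₁`,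
and for `j₁ < j₂` in a common block `V_j` of `B`, `w j₁ > w j₂`. -/
def WSet (ℓ k r q : ℕ) (A B : ℕ → ℕ) : Set (ℕ → ℕ) :=
  {w | Set.BijOn w (Set.Icc 1 ℓ) (Set.Icc 1 ℓ) ∧ (∀ m, m ∉ Set.Icc 1 ℓ → w m = m) ∧
    (∀ s : Fin (k + 1) → ℕ, StrictMono s → (∀ i, s i ∈ Set.Icc 1 ℓ) →
      ¬ StrictAnti (fun i => w (s i))) ∧
    (∀ j < r, ∀ m₁ ∈ Block A j, ∀ m₂ ∈ Block A j, m₁ < m₂ →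
      ∀ p₁ ∈ Set.Icc 1 ℓ, ∀ p₂ ∈ Set.Icc 1 ℓ, w p₁ = m₁ → w p₂ = m₂ → p₂ < p₁) ∧
    (∀ j < q, ∀ p₁ ∈ Block B j, ∀ p₂ ∈ Block B j, p₁ < p₂ → w p₂ < w p₁)}

theorem yd_ext_col {κ κ' : YoungDiagram} (h : ∀ j, κ.colLen j = κ'.colLen j) : κ = κ' := by
  apply YoungDiagram.ext
  ext ⟨i, j⟩
  rw [YoungDiagram.mem_cells, YoungDiagram.mem_cells, YoungDiagram.mem_iff_lt_colLen,
    YoungDiagram.mem_iff_lt_colLen, h]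

theorem yd_ofCol (ν : YoungDiagram) (f : ℕ → ℕ) (hf : ∀ j, f (j+1) ≤ f j)
    (hν : ∀ j, f j ≤ ν.colLen j) : ∃ κ : YoungDiagram, ∀ j, κ.colLen j = f j := by
  have hanti : Antitone f := antitone_nat_of_succ_le hf
  have hmem : ∀ i j, (i, j) ∈ ν.cells.filter (fun c => c.1 < f c.2) ↔ i < f j := by
    intro i j
    rw [Finset.mem_filter, YoungDiagram.mem_cells, YoungDiagram.mem_iff_lt_colLen]
    have := hν j
    simp only
    omega
  refine ⟨⟨ν.cells.filter (fun c => c.1 < f c.2), ?_⟩, ?_⟩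
  · rintro ⟨i, j⟩ ⟨i', j'⟩ ⟨h1, h2⟩ h
    simp only [Finset.mem_coe] at h ⊢
    rw [hmem] at h ⊢
    have := hanti h2
    simp only at this h1
    omega
  · intro j
    refine eq_of_forall_lt_iff fun i => ?_
    rw [← YoungDiagram.mem_iff_lt_colLen, ← YoungDiagram.mem_cells]
    exact hmem i j

theorem yd_card_eq (κ : YoungDiagram) (N : ℕ) (hN : κ.colLen N = 0) :
    κ.card = ∑ j ∈ Finset.range N, κ.colLen j := by
  unfold YoungDiagram.card
  rw [Finset.card_eq_sum_card_fiberwise (f := fun c => c.2) (t := Finset.range N)]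
  · refine Finset.sum_congr rfl fun j _ => ?_
    rw [YoungDiagram.colLen_eq_card]
    rfl
  · rintro ⟨i, j⟩ h
    simp only [Finset.mem_coe, YoungDiagram.mem_cells, YoungDiagram.mem_iff_lt_colLen] at h
    simp only [Finset.coe_range, Set.mem_Iio]
    by_contra hh
    have := κ.colLen_anti N j (by omega)
    omega

theorem step_iff (τ σ : YoungDiagram) (a : ℕ) : StepSet τ a σ ↔ σ.card + a = τ.card ∧
    ∀ c, σ.colLen c ≤ τ.colLen c ∧ τ.colLen (c+1) ≤ σ.colLen c := by
  unfold StepSet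
  have key : ∀ (κ : YoungDiagram) i j, j < κ.rowLen i ↔ i < κ.colLen j := fun κ i j => by
    rw [← YoungDiagram.mem_iff_lt_colLen, ← YoungDiagram.mem_iff_lt_rowLen]
  refine and_congr_right fun _ => ⟨fun h c => ⟨?_, ?_⟩, fun h i => ⟨?_, ?_⟩⟩
  · refine le_of_forall_lt fun i hi => ?_
    rw [← key] at hi ⊢
    have := h i; omega
  · refine le_of_forall_lt fun i hi => ?_
    rw [← key] at hi ⊢
    have := h i; omega
  · refine le_of_forall_lt fun j hj => ?_
    rw [key] at hj ⊢
    have := h j; omega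
  · refine le_of_forall_lt fun j hj => ?_
    rcases j with _ | j
    · omega
    have : j < σ.rowLen i := by
      rw [key] at hj ⊢
      have := h j; omega
    omega

/-- upper bound for the columns -/
def bkHi (ν μ : YoungDiagram) : ℕ → ℕ
  | 0 => ν.colLen 0
  | c+1 => min (ν.colLen (c+1)) (μ.colLen c)

/-- lower bound for the columns -/
def bkLo (ν μ : YoungDiagram) (c : ℕ) : ℕ := max (μ.colLen c) (ν.colLen (c+1))

theorem bk_sum (ν μ : YoungDiagram) (M : ℕ) :
    ∑ c ∈ Finset.range M, (bkLo ν μ c + bkHi ν μ c) + bkHi ν μ M =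
    ∑ c ∈ Finset.range M, (μ.colLen c + ν.colLen c) + ν.colLen M := by
  induction M with
  | zero => simp [bkHi]
  | succ M ih =>
    rw [Finset.sum_range_succ, Finset.sum_range_succ]
    have : bkLo ν μ M + bkHi ν μ (M+1) = μ.colLen M + ν.colLen (M+1) := by
      simp only [bkLo, bkHi]; omega
    omega

theorem bk_exists (ν μ lam : YoungDiagram) (a b : ℕ) (h1 : StepSet ν a lam)
    (h2 : StepSet lam b μ) : ∃ κ : YoungDiagram,
      (∀ c, κ.colLen c + lam.colLen c = bkLo ν μ c + bkHi ν μ c) ∧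
      StepSet ν b κ ∧ StepSet κ a μ := by
  rw [step_iff] at h1 h2
  obtain ⟨h1c, h1⟩ := h1
  obtain ⟨h2c, h2⟩ := h2
  have hlo : ∀ c, bkLo ν μ c ≤ lam.colLen c := by
    intro c; have := h1 c; have := h2 c; simp only [bkLo]; omega
  have hhi : ∀ c, lam.colLen c ≤ bkHi ν μ c := by
    intro c
    rcases c with _ | c
    · exact (h1 0).1
    · have := h1 (c+1); have := h2 c; simp only [bkHi]; omega
  have hhiν : ∀ c, bkHi ν μ c ≤ ν.colLen c := by
    intro c
    rcases c with _ | c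
    · exact le_rfl
    · simp only [bkHi]; omega
  have hhiμ : ∀ c, bkHi ν μ (c+1) ≤ μ.colLen c := by
    intro c; simp only [bkHi]; omega
  have hloμ : ∀ c, μ.colLen c ≤ bkLo ν μ c := by
    intro c; simp only [bkLo]; omega
  have hloν : ∀ c, ν.colLen (c+1) ≤ bkLo ν μ c := by
    intro c; simp only [bkLo]; omega
  obtain ⟨κ, hκ⟩ := yd_ofCol ν (fun c => bkLo ν μ c + bkHi ν μ c - lam.colLen c)
    (by intro c
        have := hlo c; have := hhi c; have := hlo (c+1); have := hhi (c+1)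
        have := hhiμ c; have := hloμ c
        omega)
    (by intro c
        have := hlo c; have := hhi c; have := hhiν c
        omega)
  have hκ' : ∀ c, κ.colLen c + lam.colLen c = bkLo ν μ c + bkHi ν μ c := by
    intro c; rw [hκ]; have := hhi c; omega
  have hz : ν.colLen (ν.rowLen 0) = 0 := by
    by_contra h
    have : (0, ν.rowLen 0) ∈ ν := by rw [YoungDiagram.mem_iff_lt_colLen]; omega
    rw [YoungDiagram.mem_iff_lt_rowLen] at this
    omega
  generalize ν.rowLen 0 = N at hz
  have hzl : lam.colLen N = 0 := by have := h1 N; omega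
  have hzμ : μ.colLen N = 0 := by have := h2 N; omega
  have hzκ : κ.colLen N = 0 := by have := hκ' N; have := hlo N; have := hhiν N; omega
  have hs := bk_sum ν μ N
  have h0 : bkHi ν μ N = 0 := by have := hhiν N; omega
  have hcard : κ.card + lam.card = μ.card + ν.card := by
    rw [yd_card_eq κ N hzκ, yd_card_eq lam N hzl, yd_card_eq μ N hzμ, yd_card_eq ν N hz,
      ← Finset.sum_add_distrib, ← Finset.sum_add_distrib, Finset.sum_congr rfl fun c _ => hκ' c]
    omega
  refine ⟨κ, hκ', (step_iff _ _ _).2 ⟨by omega, fun c => ?_⟩,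
    (step_iff _ _ _).2 ⟨by omega, fun c => ?_⟩⟩
  · have := hκ' c; have := hlo c; have := hhi c; have := hhiν c; have := hloν c; omega
  · have := hκ' c; have := hlo c; have := hhi c; have := hhiν c; have := hloμ c
    have := hκ' (c+1); have := hlo (c+1); have := hhi (c+1); have := hhiμ c; omega

theorem bk_equiv (ν μ : YoungDiagram) (a b : ℕ) :
    Nonempty ({lam // StepSet ν a lam ∧ StepSet lam b μ} ≃
      {lam // StepSet ν b lam ∧ StepSet lam a μ}) := by
  choose! F hF using fun a b lam => fun (h : StepSet ν a lam ∧ StepSet lam b μ) =>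
    bk_exists ν μ lam a b h.1 h.2
  have inv : ∀ a b lam, StepSet ν a lam ∧ StepSet lam b μ → F b a (F a b lam) = lam := by
    intro a b lam h
    have e1 := hF a b lam h
    have e2 := hF b a _ e1.2
    apply yd_ext_col
    intro j
    have := e1.1 j
    have := e2.1 j
    omega
  exact ⟨{ toFun := fun x => ⟨F a b x.1, (hF a b x.1 x.2).2⟩
           invFun := fun x => ⟨F b a x.1, (hF b a x.1 x.2).2⟩
           left_inv := fun x => Subtype.ext (inv a b x.1 x.2)
           right_inv := fun x => Subtype.ext (inv b a x.1 x.2) }⟩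

/-- chains of vertical strips -/
def Ch : List ℕ → YoungDiagram → Type
  | [], τ => PLift (τ = ⊥)
  | a :: L, τ => Σ σ : {σ // StepSet τ a σ}, Ch L σ.1

/-- regrouping a two step chain -/
def ch_two (a b : ℕ) (L : List ℕ) (τ : YoungDiagram) : Ch (a :: b :: L) τ ≃
    Σ μ : YoungDiagram, {lam // StepSet τ a lam ∧ StepSet lam b μ} × Ch L μ where
  toFun x := ⟨x.2.1.1, ⟨x.1.1, x.1.2, x.2.1.2⟩, x.2.2⟩
  invFun x := ⟨⟨x.2.1.1, x.2.1.2.1⟩, ⟨x.1, x.2.1.2.2⟩, x.2.2⟩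
  left_inv _ := rfl
  right_inv _ := rfl

theorem ch_perm {L L' : List ℕ} (h : L.Perm L') : ∀ τ, Nonempty (Ch L τ ≃ Ch L' τ) := by
  induction h with
  | nil => exact fun τ => ⟨Equiv.refl _⟩
  | cons a _ ih =>
    exact fun τ => ⟨Equiv.sigmaCongrRight fun σ => (ih σ.1).some⟩
  | swap a b L =>
    exact fun τ => ⟨(ch_two _ _ L τ).trans ((Equiv.sigmaCongrRight fun μ =>
      Equiv.prodCongr (bk_equiv τ μ b a).some (Equiv.refl _)).trans (ch_two _ _ L τ).symm)⟩
  | trans _ _ ih1 ih2 => exact fun τ => ⟨(ih1 τ).some.trans (ih2 τ).some⟩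

/-- chains as functions -/
def RC (n : ℕ) (A : ℕ → ℕ) (τ : YoungDiagram) (P : Fin n → YoungDiagram) : Prop :=
  (∀ i : Fin n, (i : ℕ) = 0 → StepSet τ (A 0) (P i)) ∧
  (∀ i i' : Fin n, (i' : ℕ) = (i : ℕ) + 1 → StepSet (P i) (A (i' : ℕ)) (P i')) ∧
  (∀ i : Fin n, (i : ℕ) + 1 = n → IsColumn (A n) (P i)) ∧
  (n = 0 → IsColumn (A 0) τ)

theorem column_iff (a : ℕ) (τ : YoungDiagram) : IsColumn a τ ↔ StepSet τ a ⊥ := by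
  have hb : ∀ i, (⊥ : YoungDiagram).rowLen i = 0 := by
    intro i
    by_contra h
    have : (i, 0) ∈ (⊥ : YoungDiagram) := by rw [YoungDiagram.mem_iff_lt_rowLen]; omega
    exact YoungDiagram.notMem_bot _ this
  have key : ∀ (κ : YoungDiagram) i j, j < κ.rowLen i ↔ i < κ.colLen j := fun κ i j => by
    rw [← YoungDiagram.mem_iff_lt_colLen, ← YoungDiagram.mem_iff_lt_rowLen]
  have hcard : (∀ i, τ.rowLen i ≤ 1) → τ.card = τ.colLen 0 := by
    intro h
    rw [yd_card_eq τ 1, Finset.sum_range_one]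
    by_contra hh
    have : 1 < τ.rowLen 0 := by rw [key]; omega
    have := h 0
    omega
  unfold StepSet IsColumn
  have hb0 : (⊥ : YoungDiagram).card = 0 := by simp [YoungDiagram.card]
  simp only [hb, hb0]
  constructor
  · intro h
    have h1 : ∀ i, τ.rowLen i ≤ 1 := by intro i; rw [h]; split <;> omega
    refine ⟨?_, fun i => ⟨by omega, by have := h1 i; omega⟩⟩
    rw [hcard h1, zero_add]
    refine eq_of_forall_lt_iff fun i => ?_
    rw [← key, h]
    split <;> omega
  · rintro ⟨h0, h⟩ i
    have h1 : ∀ i, τ.rowLen i ≤ 1 := by intro i; have := h i; omega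
    rw [hcard h1] at h0
    have := h1 i
    have := key τ i 0
    split <;> omega

theorem rc_equiv (n : ℕ) : ∀ (A : ℕ → ℕ) (τ : YoungDiagram),
    Nonempty ({P // RC n A τ P} ≃ Ch ((List.range (n+1)).map A) τ) := by
  induction n with
  | zero =>
    intro A τ
    have e : ∀ P, RC 0 A τ P ↔ StepSet τ (A 0) ⊥ := by
      intro P
      rw [← column_iff]
      exact ⟨fun h => h.2.2.2 rfl, fun h => ⟨fun i => i.elim0, fun i => i.elim0,
        fun i => i.elim0, fun _ => h⟩⟩
    exact ⟨{ toFun := fun P => ⟨⟨⊥, (e P.1).1 P.2⟩, ⟨rfl⟩⟩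
             invFun := fun x => ⟨fun i => i.elim0, (e _).2 (by
               obtain ⟨⟨σ, hσ⟩, ⟨h⟩⟩ := x
               simp only at h
               subst h
               exact hσ)⟩
             left_inv := fun P => Subtype.ext (by funext i; exact i.elim0)
             right_inv := by
               rintro ⟨⟨σ, hσ⟩, ⟨h⟩⟩
               simp only at h
               subst h
               rfl }⟩
  | succ n ih =>
    intro A τ
    rw [List.range_succ_eq_map, List.map_cons, List.map_map]
    have e : ∀ (σ : YoungDiagram) P, RC (n+1) A τ (Fin.cons σ P) ↔
        StepSet τ (A 0) σ ∧ RC n (A ∘ Nat.succ) σ P := by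
      intro σ P
      constructor
      · rintro ⟨h1, h2, h3, -⟩
        refine ⟨h1 0 rfl, ?_, ?_, ?_, ?_⟩
        · intro i hi
          have := h2 0 i.succ (by simp [hi])
          simpa [hi] using this
        · intro i i' hi
          have := h2 i.succ i'.succ (by simp [hi])
          simpa using this
        · intro i hi
          have := h3 i.succ (by simp [hi])
          simpa using this
        · intro hn
          subst hn
          simpa using h3 0 (by simp)
      · rintro ⟨h0, h1, h2, h3, h4⟩
        refine ⟨?_, ?_, ?_, by simp⟩
        · intro i hi
          obtain rfl : i = 0 := Fin.ext hi
          exact h0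
        · intro i i' hi
          induction i' using Fin.cases with
          | zero => simp at hi
          | succ i' =>
          induction i using Fin.cases with
          | zero =>
            have hi' : (i' : ℕ) = 0 := by simpa using hi
            have := h1 i' hi'
            simpa [hi'] using this
          | succ i =>
            have := h2 i i' (by simpa using hi)
            simpa using this
        · intro i hi
          induction i using Fin.cases with
          | zero =>
            have hn : n = 0 := by simpa using hi.symm
            subst hn
            simpa using h4 rfl
          | succ i =>
            have := h3 i (by simpa using hi)
            simpa using this
    refine ⟨Equiv.trans ?_ (Equiv.sigmaCongrRight fun σ : {σ // StepSet τ (A 0) σ} =>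
      (ih (A ∘ Nat.succ) σ.1).some)⟩
    exact { toFun := fun P => 
              have h := (e (P.1 0) (Fin.tail P.1)).1 (by rw [Fin.cons_self_tail]; exact P.2)
              ⟨⟨P.1 0, h.1⟩, ⟨Fin.tail P.1, h.2⟩⟩
            invFun := fun x => ⟨Fin.cons x.1.1 x.2.1, (e _ _).2 ⟨x.1.2, x.2.2⟩⟩
            left_inv := fun P => Subtype.ext (Fin.cons_self_tail _)
            right_inv := fun x => rfl }

/-- tableaux with the block condition -/
def IsTab (r : ℕ) (A : ℕ → ℕ) (μ : YoungDiagram) (T : ℕ → ℕ → ℕ) : Prop :=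
  μ.card = ∑ i ∈ Finset.range r, A i ∧ IsSYT μ T ∧ BlockRowCond r A μ T

theorem syt_range {μ : YoungDiagram} {T : ℕ → ℕ → ℕ} (h : IsSYT μ T) {i j : ℕ}
    (hm : (i, j) ∈ μ) : 1 ≤ T i j ∧ T i j ≤ μ.card := by
  have : T i j ∈ Finset.Icc 1 μ.card := by
    rw [← h.2.2.2.1]
    exact Finset.mem_image.2 ⟨(i, j), hm, rfl⟩
  simpa using this

theorem syt_surj {μ : YoungDiagram} {T : ℕ → ℕ → ℕ} (h : IsSYT μ T) {m : ℕ}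
    (h1 : 1 ≤ m) (h2 : m ≤ μ.card) : ∃ i j, (i, j) ∈ μ ∧ T i j = m := by
  have : m ∈ μ.cells.image (fun c => T c.1 c.2) := by
    rw [h.2.2.2.1]; simp [h1, h2]
  obtain ⟨⟨i, j⟩, hc, rfl⟩ := Finset.mem_image.1 this
  exact ⟨i, j, hc, rfl⟩

theorem tab_restrict {r : ℕ} {A : ℕ → ℕ} {τ : YoungDiagram} {T : ℕ → ℕ → ℕ}
    (h : IsTab (r+1) A τ T) : ∃ σ : YoungDiagram,
      (∀ i j, (i, j) ∈ σ ↔ (i, j) ∈ τ ∧ T i j ≤ ∑ i ∈ Finset.range r, A i) ∧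
      StepSet τ (A r) σ ∧
      IsTab r A σ (fun i j => if T i j ≤ ∑ i ∈ Finset.range r, A i then T i j else 0) := by
  obtain ⟨hc, hT, hB⟩ := h
  have hBr := hB r (by omega)
  simp only [Block, Finset.mem_Ioc] at hBr
  rw [Finset.sum_range_succ] at hc hBr
  have hB' : ∀ j < r, ∀ m ∈ Block A j, m ≤ ∑ i ∈ Finset.range r, A i := by
    intro j hj m hm
    simp only [Block, Finset.mem_Ioc] at hm
    exact hm.2.trans (Finset.sum_le_sum_of_subset (by
      intro x; simp only [Finset.mem_range]; omega))
  unfold IsTab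
  generalize ∑ i ∈ Finset.range r, A i = n at *
  have hlow : ∀ i j i' j', i' ≤ i → j' ≤ j → (i, j) ∈ τ → T i' j' ≤ T i j := by
    intro i j i' j' hi hj hm
    have h1 : T i j' ≤ T i j := by
      rcases hj.eq_or_lt with rfl | hj
      · rfl
      · exact (hT.1 i j' j hj hm).le
    have h2 : T i' j' ≤ T i j' := by
      rcases hi.eq_or_lt with rfl | hi
      · rfl
      · exact (hT.2.1 i' i j' hi (τ.up_left_mem le_rfl hj hm)).le
    omega
  let σ : YoungDiagram := ⟨τ.cells.filter (fun c => T c.1 c.2 ≤ n), by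
    rintro ⟨i, j⟩ ⟨i', j'⟩ ⟨h1, h2⟩ hh
    simp only [Finset.coe_filter, Set.mem_ofPred_eq, YoungDiagram.mem_cells] at hh ⊢
    exact ⟨τ.up_left_mem h1 h2 hh.1, (hlow _ _ _ _ h1 h2 hh.1).trans hh.2⟩⟩
  have hσ : ∀ i j, (i, j) ∈ σ ↔ (i, j) ∈ τ ∧ T i j ≤ n := by
    intro i j
    change (i, j) ∈ τ.cells.filter (fun c => T c.1 c.2 ≤ n) ↔ _
    simp
  have hinj : Set.InjOn (fun c : ℕ × ℕ => T c.1 c.2) ↑σ.cells :=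
    hT.2.2.2.2.mono (by
      rintro ⟨i, j⟩ hh
      exact ((hσ i j).1 hh).1)
  have himg : σ.cells.image (fun c => T c.1 c.2) = Finset.Icc 1 n := by
    ext m
    simp only [Finset.mem_image, Finset.mem_Icc, Prod.exists, YoungDiagram.mem_cells]
    constructor
    · rintro ⟨i, j, hm, rfl⟩
      rw [hσ] at hm
      exact ⟨(syt_range hT hm.1).1, hm.2⟩
    · rintro ⟨h1, h2⟩
      obtain ⟨i, j, hm, rfl⟩ := syt_surj hT h1 (by omega)
      exact ⟨i, j, (hσ i j).2 ⟨hm, h2⟩, rfl⟩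
  have hcard : σ.card = n := by
    have := congrArg Finset.card himg
    rw [Finset.card_image_of_injOn hinj] at this
    simpa using this
  have hval : ∀ i j, (i, j) ∈ σ → (if T i j ≤ n then T i j else 0) = T i j := by
    intro i j hm
    rw [if_pos ((hσ i j).1 hm).2]
  refine ⟨σ, hσ, ⟨by omega, fun i => ⟨?_, ?_⟩⟩, hcard, ⟨?_, ?_, ?_, ?_, ?_⟩, ?_⟩
  · refine le_of_forall_lt fun j hj => ?_
    rw [← YoungDiagram.mem_iff_lt_rowLen] at hj ⊢
    exact ((hσ i j).1 hj).1
  · by_contra hlt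
    have h1 : (i, σ.rowLen i + 1) ∈ τ := by rw [YoungDiagram.mem_iff_lt_rowLen]; omega
    have h0 : (i, σ.rowLen i) ∈ τ := by rw [YoungDiagram.mem_iff_lt_rowLen]; omega
    have h2 : (i, σ.rowLen i) ∉ σ := by rw [YoungDiagram.mem_iff_lt_rowLen]; omega
    rw [hσ] at h2
    have h3 := hT.1 i (σ.rowLen i) (σ.rowLen i + 1) (by omega) h1
    have h4 : n < T i (σ.rowLen i) := by
      by_contra h5; exact h2 ⟨h0, by omega⟩
    have := (syt_range hT h0).2
    have := (syt_range hT h1).2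
    have := hBr _ ⟨h4, by omega⟩ _ ⟨by omega, by omega⟩ h3 (i, σ.rowLen i) h0
      (i, σ.rowLen i + 1) h1 rfl rfl
    simp at this
  · intro i j1 j2 hj hm
    simp only
    rw [hval i j2 hm, hval i j1 (σ.up_left_mem le_rfl hj.le hm)]
    exact hT.1 i j1 j2 hj ((hσ _ _).1 hm).1
  · intro i1 i2 j hi hm
    simp only
    rw [hval i2 j hm, hval i1 j (σ.up_left_mem hi.le le_rfl hm)]
    exact hT.2.1 i1 i2 j hi ((hσ _ _).1 hm).1
  · intro i j hm
    simp only
    split_ifs with hle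
    · exact hT.2.2.1 i j fun hh => hm ((hσ _ _).2 ⟨hh, hle⟩)
    · rfl
  · rw [hcard, ← himg]
    refine Finset.image_congr ?_
    rintro ⟨i, j⟩ hm
    exact hval i j hm
  · refine hinj.congr ?_
    rintro ⟨i, j⟩ hm
    exact (hval i j hm).symm
  · rintro j hj m₁ hm₁ m₂ hm₂ hlt ⟨i1, j1⟩ hc1 ⟨i2, j2⟩ hc2 e1 e2
    simp only at e1 e2
    rw [hval _ _ hc1] at e1
    rw [hval _ _ hc2] at e2
    exact hB j (by omega) m₁ hm₁ m₂ hm₂ hlt (i1, j1) ((hσ _ _).1 hc1).1 (i2, j2)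
      ((hσ _ _).1 hc2).1 e1 e2

theorem tab_formula {r : ℕ} {A : ℕ → ℕ} {τ : YoungDiagram} {T : ℕ → ℕ → ℕ}
    (h : IsTab (r+1) A τ T) {i j : ℕ} (hm : (i, j) ∈ τ)
    (hn : ∑ i ∈ Finset.range r, A i < T i j) :
    T i j = ∑ i ∈ Finset.range r, A i +
      (τ.cells.filter (fun d => ∑ i ∈ Finset.range r, A i < T d.1 d.2 ∧ d.1 ≤ i)).card := by
  obtain ⟨hc, hT, hB⟩ := h
  have hBr := hB r (by omega)
  simp only [Block, Finset.mem_Ioc] at hBr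
  rw [Finset.sum_range_succ] at hc hBr
  generalize ∑ i ∈ Finset.range r, A i = n at *
  have himg : (τ.cells.filter (fun d => n < T d.1 d.2 ∧ d.1 ≤ i)).image (fun c => T c.1 c.2)
      = Finset.Ioc n (T i j) := by
    ext m
    simp only [Finset.mem_image, Finset.mem_Ioc, Prod.exists, Finset.mem_filter,
      YoungDiagram.mem_cells]
    have hij := (syt_range hT hm).2
    constructor
    · rintro ⟨i', j', ⟨hm', h1, h2⟩, rfl⟩
      refine ⟨h1, ?_⟩
      by_contra hlt
      have := (syt_range hT hm').2
      have := hBr (T i j) ⟨hn, by omega⟩ (T i' j') ⟨h1, by omega⟩ (by omega) (i, j) hm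
        (i', j') hm' rfl rfl
      simp only at this
      omega
    · rintro ⟨h1, h2⟩
      obtain ⟨i', j', hm', rfl⟩ := syt_surj hT (m := m) (by omega) (by omega)
      refine ⟨i', j', ⟨hm', h1, ?_⟩, rfl⟩
      rcases h2.eq_or_lt with he | hlt
      · have : ((i', j') : ℕ × ℕ) = (i, j) := hT.2.2.2.2 hm' hm he
        simp only [Prod.mk.injEq] at this
        omega
      · exact (hBr _ ⟨h1, by omega⟩ _ ⟨hn, by omega⟩ hlt (i', j') hm' (i, j) hm rfl rfl).le
  have := congrArg Finset.card himg
  rw [Finset.card_image_of_injOn (hT.2.2.2.2.mono (by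
    intro x hx
    simp only [Finset.coe_filter, Set.mem_ofPred_eq] at hx
    exact hx.1)), Nat.card_Ioc] at this
  omega

theorem tab_extend {r : ℕ} {A : ℕ → ℕ} {τ σ : YoungDiagram} {T' : ℕ → ℕ → ℕ}
    (hs : StepSet τ (A r) σ) (h : IsTab r A σ T') : ∃ T, IsTab (r+1) A τ T ∧
      (∀ i j, (i, j) ∈ σ → T i j = T' i j) ∧
      (∀ i j, (i, j) ∈ τ → (i, j) ∉ σ → ∑ i ∈ Finset.range r, A i < T i j) := by
  classical
  obtain ⟨hc, hT, hB⟩ := h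
  obtain ⟨hsc, hs⟩ := hs
  have hsub : ∀ i j, (i, j) ∈ σ → (i, j) ∈ τ := by
    intro i j
    rw [YoungDiagram.mem_iff_lt_rowLen, YoungDiagram.mem_iff_lt_rowLen]
    have := hs i; omega
  have hstrip : ∀ i j j', (i, j) ∈ τ → (i, j') ∉ σ → j ≤ j' := by
    intro i j j'
    rw [YoungDiagram.mem_iff_lt_rowLen, YoungDiagram.mem_iff_lt_rowLen]
    have := hs i; omega
  have hB' : ∀ j < r, ∀ m ∈ Block A j, m ≤ ∑ i ∈ Finset.range r, A i := by
    intro j hj m hm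
    simp only [Block, Finset.mem_Ioc] at hm
    exact hm.2.trans (Finset.sum_le_sum_of_subset (by
      intro x; simp only [Finset.mem_range]; omega))
  have hsum := Finset.sum_range_succ A r
  have hblk : Block A r = Finset.Ioc (∑ i ∈ Finset.range r, A i)
    (∑ i ∈ Finset.range r, A i + A r) := by rw [Block, hsum]
  unfold IsTab
  rw [hsum]
  generalize ∑ i ∈ Finset.range r, A i = n at *
  let D := τ.cells \ σ.cells
  have hD : ∀ i j, (i, j) ∈ D ↔ (i, j) ∈ τ ∧ (i, j) ∉ σ := by
    intro i j; simp [D]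
  have hDc : D.card = A r := by
    have : D.card = τ.cells.card - σ.cells.card :=
      Finset.card_sdiff_of_subset (by rintro ⟨i, j⟩ hx; exact hsub i j hx)
    change D.card = τ.card - σ.card at this
    omega
  let g : ℕ → ℕ := fun i => (D.filter (fun d => d.1 ≤ i)).card
  have gmono : ∀ i i', i ≤ i' → g i ≤ g i' := by
    intro i i' hi
    refine Finset.card_le_card ?_
    intro d
    simp only [Finset.mem_filter]
    rintro ⟨h1, h2⟩
    exact ⟨h1, by omega⟩
  have glt : ∀ i i' j, i < i' → (i', j) ∈ D → g i < g i' := by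
    intro i i' j hi hd
    refine Finset.card_lt_card ((Finset.ssubset_iff_of_subset ?_).2 ⟨(i', j), ?_, ?_⟩)
    · intro d
      simp only [Finset.mem_filter]
      rintro ⟨h1, h2⟩
      exact ⟨h1, by omega⟩
    · simp [hd]
    · simp [hi]
  have gpos : ∀ i j, (i, j) ∈ D → 0 < g i := by
    intro i j hd
    exact Finset.card_pos.2 ⟨(i, j), by simp [hd]⟩
  have gle : ∀ i, g i ≤ A r := by
    intro i
    rw [← hDc]
    exact Finset.card_le_card (Finset.filter_subset _ _)
  let T : ℕ → ℕ → ℕ := fun i j => if (i, j) ∈ σ then T' i j else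
    if (i, j) ∈ τ then n + g i else 0
  have T1 : ∀ i j, (i, j) ∈ σ → T i j = T' i j := by
    intro i j hm; simp only [T, if_pos hm]
  have T2 : ∀ i j, (i, j) ∈ τ → (i, j) ∉ σ → T i j = n + g i := by
    intro i j hm hm'; simp only [T, if_pos hm, if_neg hm']
  have T1le : ∀ i j, (i, j) ∈ σ → 1 ≤ T i j ∧ T i j ≤ n := by
    intro i j hm
    rw [T1 i j hm]
    have := syt_range hT hm
    omega
  have T2lt : ∀ i j, (i, j) ∈ τ → (i, j) ∉ σ → n < T i j ∧ T i j ≤ n + A r := by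
    intro i j hm hm'
    rw [T2 i j hm hm']
    have := gpos i j ((hD i j).2 ⟨hm, hm'⟩)
    have := gle i
    omega
  have hinj : Set.InjOn (fun c : ℕ × ℕ => T c.1 c.2) ↑τ.cells := by
    rintro ⟨i, j⟩ hm ⟨i', j'⟩ hm' he
    simp only [Finset.mem_coe, YoungDiagram.mem_cells] at hm hm' he
    by_cases h1 : (i, j) ∈ σ <;> by_cases h2 : (i', j') ∈ σ
    · rw [T1 _ _ h1, T1 _ _ h2] at he
      exact hT.2.2.2.2 h1 h2 he
    · have := T1le _ _ h1; have := T2lt _ _ hm' h2; omega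
    · have := T1le _ _ h2; have := T2lt _ _ hm h1; omega
    · rw [T2 _ _ hm h1, T2 _ _ hm' h2] at he
      have hii : i = i' := by
        rcases lt_trichotomy i i' with hl | hl | hl
        · have := glt i i' j' hl ((hD _ _).2 ⟨hm', h2⟩); omega
        · exact hl
        · have := glt i' i j hl ((hD _ _).2 ⟨hm, h1⟩); omega
      subst hii
      have := hstrip i j j' hm h2
      have := hstrip i j' j hm' h1
      rw [Prod.mk.injEq]; omega
  refine ⟨T, ⟨by omega, ⟨?_, ?_, ?_, ?_, hinj⟩, ?_⟩, T1, fun i j h1 h2 => (T2lt i j h1 h2).1⟩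
  · intro i j1 j2 hj hm
    by_cases h2 : (i, j2) ∈ σ
    · rw [T1 _ _ h2, T1 _ _ (σ.up_left_mem le_rfl hj.le h2)]
      exact hT.1 i j1 j2 hj h2
    · by_cases h1 : (i, j1) ∈ σ
      · have := T1le _ _ h1; have := T2lt _ _ hm h2; omega
      · have := hstrip i j2 j1 hm h1; omega
  · intro i1 i2 j hi hm
    by_cases h2 : (i2, j) ∈ σ
    · rw [T1 _ _ h2, T1 _ _ (σ.up_left_mem hi.le le_rfl h2)]
      exact hT.2.1 i1 i2 j hi h2
    · by_cases h1 : (i1, j) ∈ σ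
      · have := T1le _ _ h1; have := T2lt _ _ hm h2; omega
      · rw [T2 _ _ hm h2, T2 _ _ (τ.up_left_mem hi.le le_rfl hm) h1]
        have := glt i1 i2 j hi ((hD _ _).2 ⟨hm, h2⟩)
        omega
  · intro i j hm
    simp only [T, if_neg hm, if_neg (fun hh => hm (hsub i j hh))]
  · refine Finset.eq_of_subset_of_card_le ?_ ?_
    · intro m
      simp only [Finset.mem_image, Finset.mem_Icc, Prod.exists, YoungDiagram.mem_cells]
      rintro ⟨i, j, hm, rfl⟩
      by_cases h1 : (i, j) ∈ σ
      · have := T1le _ _ h1; omega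
      · have := T2lt _ _ hm h1; omega
    · rw [Finset.card_image_of_injOn hinj]
      simp [YoungDiagram.card]
  · rintro j hj m₁ hm₁ m₂ hm₂ hlt ⟨i1, j1⟩ hc1 ⟨i2, j2⟩ hc2 e1 e2
    simp only [YoungDiagram.mem_cells] at e1 e2 hc1 hc2
    rcases Nat.lt_succ_iff_lt_or_eq.1 hj with hj | rfl
    · have l1 := hB' j hj _ hm₁
      have l2 := hB' j hj _ hm₂
      have s1 : (i1, j1) ∈ σ := by
        by_contra hh; have := T2lt _ _ hc1 hh; omega
      have s2 : (i2, j2) ∈ σ := by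
        by_contra hh; have := T2lt _ _ hc2 hh; omega
      rw [T1 _ _ s1] at e1
      rw [T1 _ _ s2] at e2
      exact hB j hj m₁ hm₁ m₂ hm₂ hlt _ s1 _ s2 e1 e2
    · rw [hblk, Finset.mem_Ioc] at hm₁ hm₂
      have s1 : (i1, j1) ∉ σ := by
        intro hh; have := T1le _ _ hh; omega
      have s2 : (i2, j2) ∉ σ := by
        intro hh; have := T1le _ _ hh; omega
      rw [T2 _ _ hc1 s1] at e1
      rw [T2 _ _ hc2 s2] at e2
      simp only
      by_contra hh
      have := gmono i2 i1 (by omega)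
      omega

theorem tab_step (r : ℕ) (A : ℕ → ℕ) (τ : YoungDiagram) :
    Nonempty ({T // IsTab (r+1) A τ T} ≃
      Σ σ : {σ // StepSet τ (A r) σ}, {T // IsTab r A σ.1 T}) := by
  let G : {p : YoungDiagram × (ℕ → ℕ → ℕ) // StepSet τ (A r) p.1 ∧ IsTab r A p.1 p.2} ≃
      Σ σ : {σ // StepSet τ (A r) σ}, {T // IsTab r A σ.1 T} :=
    { toFun := fun p => ⟨⟨p.1.1, p.2.1⟩, ⟨p.1.2, p.2.2⟩⟩
      invFun := fun x => ⟨(x.1.1, x.2.1), x.1.2, x.2.2⟩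
      left_inv := fun _ => rfl
      right_inv := fun _ => rfl }
  choose S hS using fun T (h : IsTab (r+1) A τ T) => tab_restrict h
  let F : {T // IsTab (r+1) A τ T} →
      {p : YoungDiagram × (ℕ → ℕ → ℕ) // StepSet τ (A r) p.1 ∧ IsTab r A p.1 p.2} :=
    fun T => ⟨(S T.1 T.2, fun i j => if T.1 i j ≤ ∑ i ∈ Finset.range r, A i then T.1 i j else 0),
      (hS T.1 T.2).2⟩
  refine ⟨(Equiv.ofBijective F ⟨?_, ?_⟩).trans G⟩
  · rintro ⟨T, hT⟩ ⟨T', hT'⟩ he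
    have he := congrArg Subtype.val he
    simp only [F, Prod.mk.injEq] at he
    obtain ⟨e1, e2⟩ := he
    apply Subtype.ext
    funext i j
    change T i j = T' i j
    have m1 := (hS T hT).1
    have m2 := (hS T' hT').1
    rw [e1] at m1
    have hiff : ∀ i j, (i, j) ∈ τ → (T i j ≤ ∑ i ∈ Finset.range r, A i ↔
        T' i j ≤ ∑ i ∈ Finset.range r, A i) := by
      intro i j hm
      have a1 := m1 i j
      have a2 := m2 i j
      tauto
    by_cases hm : (i, j) ∈ τ
    · have hi := hiff i j hm
      by_cases hle : T i j ≤ ∑ i ∈ Finset.range r, A i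
      · have := congrFun (congrFun e2 i) j
        rwa [if_pos hle, if_pos (hi.1 hle)] at this
      · rw [tab_formula hT hm (by omega), tab_formula hT' hm (by omega)]
        congr 2
        refine Finset.filter_congr ?_
        rintro ⟨i', j'⟩ hm'
        have := hiff i' j' hm'
        change _ < T i' j' ∧ i' ≤ i ↔ _ < T' i' j' ∧ i' ≤ i
        omega
    · rw [hT.2.1.2.2.1 i j hm, hT'.2.1.2.2.1 i j hm]
  · rintro ⟨⟨σ, T'⟩, hs, hT'⟩
    obtain ⟨T, hT, t1, t2⟩ := tab_extend hs hT'
    refine ⟨⟨T, hT⟩, Subtype.ext ?_⟩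
    simp only at hs hT'
    have m1 := (hS T hT).1
    have hsub : ∀ i j, (i, j) ∈ σ → (i, j) ∈ τ := by
      intro i j
      rw [YoungDiagram.mem_iff_lt_rowLen, YoungDiagram.mem_iff_lt_rowLen]
      have := hs.2 i; omega
    have hle : ∀ i j, (i, j) ∈ σ → T i j ≤ ∑ i ∈ Finset.range r, A i := by
      intro i j hm
      rw [t1 i j hm, ← hT'.1]
      exact (syt_range hT'.2.1 hm).2
    simp only [F, Prod.mk.injEq]
    constructor
    · apply YoungDiagram.ext
      ext ⟨i, j⟩
      rw [YoungDiagram.mem_cells, YoungDiagram.mem_cells, m1]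
      constructor
      · rintro ⟨h1, h2⟩
        by_contra h3
        have := t2 i j h1 h3
        omega
      · exact fun h => ⟨hsub i j h, hle i j h⟩
    · funext i j
      by_cases hm : (i, j) ∈ σ
      · rw [if_pos (hle i j hm), t1 i j hm]
      · rw [hT'.2.1.2.2.1 i j hm]
        by_cases hm' : (i, j) ∈ τ
        · rw [if_neg]
          have := t2 i j hm' hm
          omega
        · rw [hT.2.1.2.2.1 i j hm']
          simp

theorem tab_equiv (A : ℕ → ℕ) (r : ℕ) : ∀ τ : YoungDiagram,
    Nonempty ({T // IsTab r A τ T} ≃ Ch ((List.range r).map A).reverse τ) := by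
  induction r with
  | zero =>
    intro τ
    have hz : ∀ T, IsTab 0 A τ T → τ = ⊥ ∧ T = fun _ _ => 0 := by
      rintro T ⟨hc, hT, -⟩
      have : τ = ⊥ := by
        apply YoungDiagram.ext
        rw [YoungDiagram.cells_bot]
        exact Finset.card_eq_zero.1 (by simpa using hc)
      subst this
      refine ⟨rfl, ?_⟩
      funext i j
      exact hT.2.2.1 i j (YoungDiagram.notMem_bot _)
    exact ⟨{ toFun := fun T => ⟨(hz T.1 T.2).1⟩
             invFun := fun x => ⟨fun _ _ => 0, by
               obtain ⟨h⟩ := x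
               subst h
               refine ⟨by simp, ⟨?_, ?_, ?_, ?_, ?_⟩, ?_⟩
               · intro i j1 j2 _ hm; exact absurd hm (YoungDiagram.notMem_bot _)
               · intro i j1 j2 _ hm; exact absurd hm (YoungDiagram.notMem_bot _)
               · intros; rfl
               · simp
               · simp
               · intro j hj; omega⟩
             left_inv := fun T => Subtype.ext (hz T.1 T.2).2.symm
             right_inv := fun _ => rfl }⟩
  | succ r ih =>
    intro τ
    rw [List.range_succ, List.map_append, List.reverse_append]
    exact ⟨(tab_step r A τ).some.trans (Equiv.sigmaCongrRight fun σ => (ih σ.1).some)⟩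

theorem rc_tab_equiv (n : ℕ) (A : ℕ → ℕ) (τ : YoungDiagram) :
    Nonempty ({P // RC n A τ P} ≃ {T // IsTab (n+1) A τ T}) :=
  ⟨(rc_equiv n A τ).some.trans ((ch_perm (List.reverse_perm _).symm τ).some.trans
    (tab_equiv A (n+1) τ).some.symm)⟩

/-- `|R^ℓ_{A,B}| = |S^ℓ_{A,B}|`. -/
theorem card_RSet_eq_card_SSet (ℓ k r q : ℕ) (A B : ℕ → ℕ)
    (hℓ : 1 ≤ ℓ) (hk : 1 ≤ k) (hr : 2 ≤ r) (hq : 2 ≤ q)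
    (hAanti : ∀ i j, i ≤ j → j < r → A j ≤ A i)
    (hApos : ∀ i, i < r → 1 ≤ A i)
    (hAsum : ∑ i ∈ Finset.range r, A i = ℓ)
    (hBanti : ∀ i j, i ≤ j → j < q → B j ≤ B i)
    (hBpos : ∀ i, i < q → 1 ≤ B i)
    (hBsum : ∑ i ∈ Finset.range q, B i = ℓ)
    (hab : A 0 + B 0 ≤ k) :
    (RSet ℓ k r q A B).ncard = (SYTPairSet ℓ k r q A B).ncard := by
  obtain ⟨n, rfl⟩ : ∃ n, r = n + 2 := ⟨r - 2, by omega⟩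
  obtain ⟨m, rfl⟩ : ∃ m, q = m + 2 := ⟨q - 2, by omega⟩
  rw [← Nat.card_coe_set_eq, ← Nat.card_coe_set_eq]
  let X := {τ : YoungDiagram // τ.card = ℓ ∧ τ.colLen 0 ≤ k ∧ τ.rowLen 0 ≤ min (n+2) (m+2)}
  let e1 : RSet ℓ k (n+2) (m+2) A B ≃
      Σ τ : X, {P // RC (n+1) A τ.1 P} × {P // RC (m+1) B τ.1 P} :=
    { toFun := fun x => ⟨⟨x.1.2.2, x.2.1, x.2.2.1, x.2.2.2.1⟩,
        ⟨x.1.1, x.2.2.2.2.1, x.2.2.2.2.2.1, fun i hi => x.2.2.2.2.2.2.1 i (by omega),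
          fun h => absurd h (by omega)⟩,
        ⟨x.1.2.1, x.2.2.2.2.2.2.2.1, x.2.2.2.2.2.2.2.2.1,
          fun i hi => x.2.2.2.2.2.2.2.2.2 i (by omega), fun h => absurd h (by omega)⟩⟩
      invFun := fun y => ⟨(y.2.1.1, y.2.2.1, y.1.1), y.1.2.1, y.1.2.2.1, y.1.2.2.2,
        y.2.1.2.1, y.2.1.2.2.1, fun i hi => y.2.1.2.2.2.1 i (by omega),
        y.2.2.2.1, y.2.2.2.2.1, fun i hi => y.2.2.2.2.2.1 i (by omega)⟩
      left_inv := fun _ => rfl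
      right_inv := fun _ => rfl }
  let e2 : SYTPairSet ℓ k (n+2) (m+2) A B ≃
      Σ τ : X, {T // IsTab (n+2) A τ.1 T} × {T // IsTab (m+2) B τ.1 T} :=
    { toFun := fun x => ⟨⟨x.1.1, x.2.1, x.2.2.1, x.2.2.2.1⟩,
        ⟨x.1.2.1, x.2.1.trans hAsum.symm, x.2.2.2.2.1, x.2.2.2.2.2.2.1⟩,
        ⟨x.1.2.2, x.2.1.trans hBsum.symm, x.2.2.2.2.2.1, x.2.2.2.2.2.2.2⟩⟩
      invFun := fun y => ⟨(y.1.1, y.2.1.1, y.2.2.1), y.1.2.1, y.1.2.2.1, y.1.2.2.2,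
        y.2.1.2.2.1, y.2.2.2.2.1, y.2.1.2.2.2, y.2.2.2.2.2⟩
      left_inv := fun _ => rfl
      right_inv := fun _ => rfl }
  exact Nat.card_congr (e1.trans ((Equiv.sigmaCongrRight fun τ : X =>
    Equiv.prodCongr (rc_tab_equiv (n+1) A τ.1).some
      (rc_tab_equiv (m+1) B τ.1).some).trans e2.symm))
end

section
/- Let ℓ, k, r, q be integers with ℓ ≥ 1, k ≥ 1, r ≥ 2, q ≥ 2, let A = (a₁ ≥ a₂ ≥ ⋯ ≥ a_r ≥ 1) and B = (b₁ ≥ b₂ ≥ ⋯ ≥ b_q ≥ 1) be partitions of ℓ with a₁ + b₁ ≤ k. Then the sets S^ℓ_{A,B} and W^ℓ_{A,B} have the same (finite) cardinality: |S^ℓ_{A,B}| = |W^ℓ_{A,B}|. -/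
section RSKAux

open Finset

def off (A : ℕ → ℕ) (j : ℕ) : ℕ := ∑ i ∈ range j, A i

lemma off_zero (A : ℕ → ℕ) : off A 0 = 0 := by simp [off]
lemma off_succ (A : ℕ → ℕ) (j : ℕ) : off A (j+1) = off A j + A j := by
  simp [off, sum_range_succ]
lemma off_mono (A : ℕ → ℕ) : Monotone (off A) :=
  monotone_nat_of_le_succ (fun n => by rw [off_succ]; omega)
lemma mem_Block (A : ℕ → ℕ) (j x : ℕ) : x ∈ Block A j ↔ off A j < x ∧ x ≤ off A (j+1) := by
  simp [Block, off]

def Itl (μ l : ℕ → ℕ) : Prop := ∀ i, μ i ≤ l i ∧ l (i+1) ≤ μ i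

def ChainS (N r : ℕ) (A : ℕ → ℕ) : Set (ℕ → ℕ → ℕ) :=
  {P | P 0 = 0 ∧ (∀ j < r, Itl (P j) (P (j+1))) ∧
    (∀ j ≤ r, ∑ c ∈ range N, P j c = off A j) ∧ ∀ j, r < j → P j = 0}

def CSet (N k r q : ℕ) (A B : ℕ → ℕ) : Set ((ℕ → ℕ → ℕ) × (ℕ → ℕ → ℕ)) :=
  {x | x.1 ∈ ChainS N r A ∧ x.2 ∈ ChainS N q B ∧ x.1 r = x.2 q ∧ x.1 r 0 ≤ k}

lemma chain_supp {r : ℕ} {P : ℕ → ℕ → ℕ} (h0 : P 0 = 0)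
    (h : ∀ j < r, Itl (P j) (P (j+1))) : ∀ j ≤ r, ∀ c, j ≤ c → P j c = 0 := by
  intro j
  induction j with
  | zero => intro _ c _; simp [h0]
  | succ j ih =>
    intro hj c hc
    obtain ⟨c, rfl⟩ : ∃ d, c = d + 1 := ⟨c - 1, by omega⟩
    have h1 := ih (by omega) c (by omega)
    have h2 := (h j (by omega) c).2
    omega

/-! Bender-Knuth -/

def tog (l μ n : ℕ → ℕ) : ℕ → ℕ
  | 0 => n 0 + max (l 0) (n (0+1)) - μ 0
  | c+1 => min (n (c+1)) (l c) + max (l (c+1)) (n (c+1+1)) - μ (c+1)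

lemma tog_inter {l μ n : ℕ → ℕ} (h1 : Itl l μ) (h2 : Itl μ n) :
    Itl l (tog l μ n) ∧ Itl (tog l μ n) n := by
  constructor
  · intro c
    have a1 := h1 c; have a2 := h2 c; have a3 := h1 (c+1); have a4 := h2 (c+1)
    cases c with
    | zero => simp only [tog]; omega
    | succ c =>
      have a5 := h1 c; have a6 := h2 c
      simp only [tog]; omega
  · intro c
    have a1 := h1 c; have a2 := h2 c; have a3 := h1 (c+1); have a4 := h2 (c+1)
    cases c with
    | zero => simp only [tog]; omega
    | succ c =>
      have a5 := h1 c; have a6 := h2 c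
      simp only [tog]; omega

lemma tog_tog {l μ n : ℕ → ℕ} (h1 : Itl l μ) (h2 : Itl μ n) :
    tog l (tog l μ n) n = μ := by
  funext c
  have a1 := h1 c; have a2 := h2 c; have a3 := h1 (c+1); have a4 := h2 (c+1)
  cases c with
  | zero => simp only [tog]; omega
  | succ c =>
    have a5 := h1 c; have a6 := h2 c
    simp only [tog]; omega

lemma tog_sum {l μ n : ℕ → ℕ} (h1 : Itl l μ) (h2 : Itl μ n) (M : ℕ)
     (hN : n M = 0) :
    ∑ c ∈ range M, tog l μ n c + ∑ c ∈ range M, μ c = ∑ c ∈ range M, l c + ∑ c ∈ range M, n c := by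
  have key : ∀ M, ∑ c ∈ range M, tog l μ n c + ∑ c ∈ range M, μ c + (if M = 0 then 0 else min (l (M-1)) (n M))
      = ∑ c ∈ range M, l c + ∑ c ∈ range M, n c + (if M = 0 then 0 else n M) := by
    intro M
    induction M with
    | zero => simp
    | succ M ih =>
      simp only [sum_range_succ]
      have a1 := h1 M; have a2 := h2 M; have a3 := h1 (M+1); have a4 := h2 (M+1)
      cases M with
      | zero => simp [tog] at *; omega
      | succ M =>
        have a5 := h1 M; have a6 := h2 M
        simp only [tog, Nat.add_sub_cancel, Nat.add_eq_zero_iff, one_ne_zero, and_false, if_false] at *; omega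
  have := key M
  split_ifs at this <;> omega

def swp (A : ℕ → ℕ) (j : ℕ) : ℕ → ℕ := fun i => if i = j then A (j+1) else if i = j+1 then A j else A i

lemma swp_swp (A : ℕ → ℕ) (j : ℕ) : swp (swp A j) j = A := by
  funext i; simp only [swp]; split_ifs <;> simp_all

lemma off_swp (A : ℕ → ℕ) (j i : ℕ) (h : i ≠ j+1) : off (swp A j) i = off A i := by
  have key : ∀ i, i ≠ j + 1 → off (swp A j) i = off A i := by
    intro i
    induction i using Nat.strong_induction_on with
    | _ i ih =>
      intro h
      rcases i with _ | i
      · simp [off]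
      · by_cases hij : i = j + 1
        · subst hij
          rw [off_succ, off_succ, off_succ, off_succ, ih j (by omega) (by omega)]
          simp [swp]; omega
        · rw [off_succ, off_succ, ih i (by omega) hij]
          have : i ≠ j := by omega
          simp [swp, hij, this]
  exact key i h

def BK (j : ℕ) (P : ℕ → ℕ → ℕ) : ℕ → ℕ → ℕ :=
  Function.update P (j+1) (tog (P j) (P (j+1)) (P (j+2)))

lemma BK_mem {N r : ℕ} {A : ℕ → ℕ} (hN : r ≤ N) {j : ℕ} (hj : j + 1 < r) {P} (hP : P ∈ ChainS N r A) :
    BK j P ∈ ChainS N r (swp A j) := by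
  obtain ⟨h0, h1, h2, h3⟩ := hP
  have ha := h1 j (by omega)
  have hb := h1 (j+1) (by omega)
  refine ⟨?_, ?_, ?_, ?_⟩
  · rw [BK, Function.update_of_ne (by omega)]; exact h0
  · intro i hi
    by_cases e1 : i = j
    · subst e1
      rw [BK, Function.update_of_ne (by omega), Function.update_self]
      exact (tog_inter ha hb).1
    by_cases e2 : i = j + 1
    · subst e2
      rw [BK, Function.update_of_ne (by omega : j+1+1 ≠ j+1), Function.update_self]
      exact (tog_inter ha hb).2
    rw [BK, Function.update_of_ne (by omega), Function.update_of_ne (by omega)]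
    exact h1 i hi
  · intro i hi
    by_cases e2 : i = j + 1
    · subst e2
      rw [BK, Function.update_self]
      have hs := tog_sum ha hb N (chain_supp h0 h1 _ (by omega) _ (by omega))
      have e1 := h2 j (by omega)
      have e2 := h2 (j+1) (by omega)
      have e3 := h2 (j+1+1) (by omega)
      rw [off_succ] at e2
      rw [off_succ, off_succ] at e3
      rw [off_succ, off_swp _ _ _ (by omega)]
      simp only [swp, if_true]
      simp only [show j + 2 = j+1+1 from rfl] at *
      omega
    · rw [BK, Function.update_of_ne e2, off_swp _ _ _ e2]
      exact h2 i hi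
  · intro i hi
    rw [BK, Function.update_of_ne (by omega)]
    exact h3 i hi

lemma BK_BK {N r : ℕ} {A : ℕ → ℕ} {j : ℕ} (hj : j + 1 < r) {P} (hP : P ∈ ChainS N r A) :
    BK j (BK j P) = P := by
  obtain ⟨h0, h1, h2, h3⟩ := hP
  have ha := h1 j (by omega)
  have hb := h1 (j+1) (by omega)
  funext i
  by_cases e : i = j + 1
  · subst e
    simp only [BK, Function.update_self]
    rw [Function.update_of_ne (by omega), Function.update_of_ne (by omega)]
    exact tog_tog ha hb
  · simp only [BK]
    rw [Function.update_of_ne e, Function.update_of_ne e]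

lemma ncard_eq_of_invOn {α β : Type*} {s : Set α} {t : Set β} (f : α → β) (g : β → α)
    (hf : ∀ x ∈ s, f x ∈ t) (hg : ∀ y ∈ t, g y ∈ s) (hgf : ∀ x ∈ s, g (f x) = x)
    (hfg : ∀ y ∈ t, f (g y) = y) : s.ncard = t.ncard := by
  apply Set.ncard_congr (fun x _ => f x) hf
  · intro a b ha hb h
    have h : f a = f b := h
    rw [← hgf a ha, ← hgf b hb, h]
  · intro b hb
    exact ⟨g b, hg b hb, hfg b hb⟩

lemma CSet_swp {N k r q : ℕ} {A B : ℕ → ℕ} (hN : r ≤ N) {j : ℕ} (hj : j + 1 < r) :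
    (CSet N k r q A B).ncard = (CSet N k r q (swp A j) B).ncard := by
  have hr : ∀ P, BK j P r = P r := fun P => by rw [BK, Function.update_of_ne (by omega)]
  apply ncard_eq_of_invOn (fun x => (BK j x.1, x.2)) (fun x => (BK j x.1, x.2))
  · rintro ⟨P, Q⟩ ⟨h1, h2, h3, h4⟩
    exact ⟨BK_mem hN hj h1, h2, by simpa [hr] using h3, by simpa [hr] using h4⟩
  · rintro ⟨P, Q⟩ ⟨h1, h2, h3, h4⟩
    refine ⟨?_, h2, by simpa [hr] using h3, by simpa [hr] using h4⟩
    have := BK_mem hN hj h1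
    rwa [swp_swp] at this
  · rintro ⟨P, Q⟩ ⟨h1, h2, h3, h4⟩
    simp [BK_BK hj h1]
  · rintro ⟨P, Q⟩ ⟨h1, h2, h3, h4⟩
    simp [BK_BK hj h1]

lemma CSet_congr {N k r q : ℕ} {A A' B : ℕ → ℕ} (h : ∀ i < r, A i = A' i) :
    CSet N k r q A B = CSet N k r q A' B := by
  have : ChainS N r A = ChainS N r A' := by
    ext P
    simp only [ChainS, Set.mem_ofPred_eq]
    have : ∀ j ≤ r, off A j = off A' j := fun j hj => by
      apply sum_congr rfl; intro i hi; apply h; simp at hi; omega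
    constructor
    · rintro ⟨h1, h2, h3, h4⟩; exact ⟨h1, h2, fun j hj => by rw [h3 j hj, this j hj], h4⟩
    · rintro ⟨h1, h2, h3, h4⟩; exact ⟨h1, h2, fun j hj => by rw [h3 j hj, this j hj], h4⟩
  simp only [CSet, this]

lemma CSet_perm {N k q : ℕ} {B : ℕ → ℕ} {l₁ l₂ : List ℕ} (h : l₁.Perm l₂) :
    ∀ pre : List ℕ, (pre ++ l₁).length ≤ N →
    (CSet N k (pre ++ l₁).length q (fun i => (pre ++ l₁).getD i 0) B).ncard
     = (CSet N k (pre ++ l₂).length q (fun i => (pre ++ l₂).getD i 0) B).ncard := by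
  induction h with
  | nil => intro pre _; rfl
  | cons x h ih =>
    intro pre hl
    have := ih (pre ++ [x]) (by simpa using hl)
    simpa using this
  | swap x y l =>
    intro pre hl
    rw [CSet_swp hl (j := pre.length) (by simp)]
    have e : (pre ++ x :: y :: l).length = (pre ++ y :: x :: l).length := by simp
    rw [e]
    congr 1
    apply CSet_congr
    intro i hi
    simp only [swp]
    split_ifs with h1 h2
    · subst h1; simp [List.getD_eq_getElem?_getD]
    · subst h2; simp [List.getD_eq_getElem?_getD]
    · simp only [List.getD_eq_getElem?_getD]
      by_cases h3 : i < pre.length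
      · simp [List.getElem?_append_left h3]
      · rw [List.getElem?_append_right (by omega), List.getElem?_append_right (by omega)]
        obtain ⟨d, hd⟩ : ∃ d, i - pre.length = d + 2 := ⟨i - pre.length - 2, by omega⟩
        rw [hd]; simp
  | trans h1 h2 ih1 ih2 =>
    intro pre hl
    rw [ih1 pre hl]
    apply ih2
    have := h1.length_eq
    simp at hl ⊢; omega

lemma CSet_rev {N k r q : ℕ} {A B : ℕ → ℕ} (hN : r ≤ N) :
    (CSet N k r q A B).ncard = (CSet N k r q (fun i => A (r - 1 - i)) B).ncard := by
  have h := CSet_perm (N := N) (k := k) (q := q) (B := B)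
    (List.reverse_perm ((List.range r).map A)).symm [] (by simpa using hN)
  simp only [List.nil_append, List.length_reverse, List.length_map, List.length_range] at h
  rw [CSet_congr (A' := fun i => ((List.range r).map A).getD i 0), h]
  · congr 1
    apply CSet_congr
    intro i hi
    simp [List.getD_eq_getElem?_getD, hi]
  · intro i hi
    simp [List.getD_eq_getElem?_getD, hi]

/-! growth -/

def stp (μ n ρ : ℕ → ℕ) (m : ℕ) : ℕ → ℕ
  | 0 => max (μ 0) (n 0) + m
  | c+1 => max (μ (c+1)) (n (c+1)) + min (μ c) (n c) - ρ c

def bck (μ n l : ℕ → ℕ) : ℕ → ℕ := fun c =>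
  max (μ (c+1)) (n (c+1)) + min (μ c) (n c) - l (c+1)

lemma stp_inter {μ n ρ : ℕ → ℕ} (m : ℕ) (h1 : Itl ρ μ) (h2 : Itl ρ n) :
    Itl μ (stp μ n ρ m) ∧ Itl n (stp μ n ρ m) := by
  constructor <;>
  · intro c
    have a1 := h1 c; have a2 := h2 c
    cases c with
    | zero => simp only [stp]; simp only [zero_add] at *; omega
    | succ c =>
      have a5 := h1 c; have a6 := h2 c
      simp only [stp]; omega

lemma bck_stp {μ n ρ : ℕ → ℕ} (m : ℕ) (h1 : Itl ρ μ) (h2 : Itl ρ n) :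
    bck μ n (stp μ n ρ m) = ρ := by
  funext c
  have a1 := h1 c; have a2 := h2 c
  simp only [bck, stp]; omega

lemma bck_inter {μ n l : ℕ → ℕ} (h1 : Itl μ l) (h2 : Itl n l) :
    Itl (bck μ n l) μ ∧ Itl (bck μ n l) n := by
  constructor <;>
  · intro c
    have a1 := h1 c; have a2 := h2 c
    have a5 := h1 (c+1); have a6 := h2 (c+1)
    simp only [bck]; omega

lemma stp_bck {μ n l : ℕ → ℕ} (h1 : Itl μ l) (h2 : Itl n l) :
    stp μ n (bck μ n l) (l 0 - max (μ 0) (n 0)) = l := by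
  funext c
  cases c with
  | zero => have a1 := h1 0; have a2 := h2 0; simp only [stp]; omega
  | succ c =>
    have a1 := h1 c; have a2 := h2 c
    have a5 := h1 (c+1); have a6 := h2 (c+1)
    simp only [stp, bck]; omega

def G (m : ℕ → ℕ → ℕ) : ℕ → ℕ → (ℕ → ℕ)
  | 0, _ => 0
  | _+1, 0 => 0
  | i+1, j+1 => stp (G m i (j+1)) (G m (i+1) j) (G m i j) (m i j)

lemma G_zero_left (m : ℕ → ℕ → ℕ) (j) : G m 0 j = 0 := by simp [G]
lemma G_zero_right (m : ℕ → ℕ → ℕ) (i) : G m i 0 = 0 := by cases i <;> simp [G]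
lemma G_succ (m : ℕ → ℕ → ℕ) (i j) : G m (i+1) (j+1) =
    stp (G m i (j+1)) (G m (i+1) j) (G m i j) (m i j) := by simp [G]

lemma inter_zero : Itl 0 0 := by intro c; simp

lemma inter_zero' {μ : ℕ → ℕ} (h : Itl μ 0) : μ = 0 := by
  funext c; have := (h c).1; simpa using this

lemma G_inter (m : ℕ → ℕ → ℕ) (i : ℕ) : ∀ j,
    Itl (G m i j) (G m (i+1) j) ∧ Itl (G m i j) (G m i (j+1)) := by
  induction i with
  | zero =>
    intro j
    induction j with
    | zero => simp [G_zero_left, G_zero_right, inter_zero]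
    | succ j ih =>
      refine ⟨?_, by simp [G_zero_left, inter_zero]⟩
      rw [G_succ]
      exact (stp_inter _ ih.2 ih.1).1
  | succ i ih =>
    intro j
    induction j with
    | zero =>
      refine ⟨by simp [G_zero_right, inter_zero], ?_⟩
      rw [G_succ]
      exact (stp_inter _ (ih 0).2 (ih 0).1).2
    | succ j ihj =>
      have h2 : Itl (G m (i+1) (j+1)) (G m (i+1) (j+1+1)) := by
        rw [G_succ m i (j+1)]
        exact (stp_inter _ (ih (j+1)).2 (ih (j+1)).1).2
      refine ⟨?_, h2⟩
      rw [G_succ m (i+1) j]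
      exact (stp_inter _ ihj.2 ihj.1).1

lemma stp_sum {μ n ρ : ℕ → ℕ} (m : ℕ) (h1 : Itl ρ μ) (h2 : Itl ρ n) (M : ℕ) (hM : μ M = 0) :
    ∑ c ∈ range (M+1), stp μ n ρ m c + ∑ c ∈ range (M+1), ρ c
      = ∑ c ∈ range (M+1), μ c + ∑ c ∈ range (M+1), n c + m := by
  have key : ∀ M, ∑ c ∈ range (M+1), stp μ n ρ m c + ∑ c ∈ range (M+1), ρ c + min (μ M) (n M)
      = ∑ c ∈ range (M+1), μ c + ∑ c ∈ range (M+1), n c + m + ρ M := by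
    intro M
    induction M with
    | zero => simp [stp]; omega
    | succ M ih =>
      rw [sum_range_succ _ (M+1), sum_range_succ ρ (M+1), sum_range_succ μ (M+1), sum_range_succ n (M+1)]
      have a1 := h1 M; have a2 := h2 M; have a3 := h1 (M+1); have a4 := h2 (M+1)
      have e : stp μ n ρ m (M+1) = max (μ (M+1)) (n (M+1)) + min (μ M) (n M) - ρ M := rfl
      omega
  have := key M
  have a := h1 M
  omega

lemma G_supp (m : ℕ → ℕ → ℕ) (i j c : ℕ) (h : i ≤ c) : G m i j c = 0 :=
  chain_supp (r := i) (P := fun i => G m i j) (G_zero_left m j) (fun i _ => (G_inter m i j).1) i le_rfl c h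

lemma G_sum (m : ℕ → ℕ → ℕ) (N : ℕ) (i : ℕ) : i ≤ N → ∀ j, ∑ c ∈ range N, G m i j c =
    ∑ i' ∈ range i, ∑ j' ∈ range j, m i' j' := by
  induction i with
  | zero => intro _ j; simp [G_zero_left]
  | succ i ih =>
    intro hi j
    induction j with
    | zero => simp [G_zero_right]
    | succ j ihj =>
      obtain ⟨M, rfl⟩ : ∃ M, N = M + 1 := ⟨N - 1, by omega⟩
      have := stp_sum (m i j) (G_inter m i j).2 (G_inter m i j).1 M (G_supp m i (j+1) M (by omega))
      rw [ih (by omega), ih (by omega), ihj, ← G_succ] at this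
      simp only [sum_range_succ, sum_add_distrib] at this ⊢
      omega

def MSet (k r q : ℕ) (A B : ℕ → ℕ) : Set (ℕ → ℕ → ℕ) :=
  {m | (∀ i j, ¬ (i < r ∧ j < q) → m i j = 0) ∧ (∀ i < r, ∑ j ∈ range q, m i j = A i) ∧
    (∀ j < q, ∑ i ∈ range r, m i j = B j) ∧ G m r q 0 ≤ k}

def Hb (P Q : ℕ → ℕ → ℕ) (r q : ℕ) : ℕ → ℕ → (ℕ → ℕ)
  | 0, b => Q (q - b)
  | a+1, 0 => P (r - (a+1))
  | a+1, b+1 => bck (Hb P Q r q (a+1) b) (Hb P Q r q a (b+1)) (Hb P Q r q a b)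

lemma Hb_succ (P Q : ℕ → ℕ → ℕ) (r q a b : ℕ) : Hb P Q r q (a+1) (b+1) =
  bck (Hb P Q r q (a+1) b) (Hb P Q r q a (b+1)) (Hb P Q r q a b) := by simp [Hb]
lemma Hb_left (P Q : ℕ → ℕ → ℕ) (r q b : ℕ) : Hb P Q r q 0 b = Q (q - b) := by simp [Hb]
lemma Hb_right (P Q : ℕ → ℕ → ℕ) (r q a : ℕ) (h : P r = Q q) : Hb P Q r q a 0 = P (r - a) := by
  cases a <;> simp [Hb, h]

lemma Hb_inter {P Q : ℕ → ℕ → ℕ} {r q : ℕ} (h : P r = Q q)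
    (hP : ∀ j < r, Itl (P j) (P (j+1))) (hQ : ∀ j < q, Itl (Q j) (Q (j+1))) (a : ℕ) : ∀ b,
    (a < r → b ≤ q → Itl (Hb P Q r q (a+1) b) (Hb P Q r q a b)) ∧
    (a ≤ r → b < q → Itl (Hb P Q r q a (b+1)) (Hb P Q r q a b)) := by
  have base : ∀ a, a < r → Itl (Hb P Q r q (a+1) 0) (Hb P Q r q a 0) := by
    intro a ha
    rw [Hb_right _ _ _ _ _ h, Hb_right _ _ _ _ _ h]
    have := hP (r - (a+1)) (by omega)
    rwa [show r - (a+1) + 1 = r - a by omega] at this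
  induction a with
  | zero =>
    have hr : ∀ b < q, Itl (Hb P Q r q 0 (b+1)) (Hb P Q r q 0 b) := by
      intro b hb
      rw [Hb_left, Hb_left]
      have := hQ (q - (b+1)) (by omega)
      rwa [show q - (b+1) + 1 = q - b by omega] at this
    intro b
    induction b with
    | zero => exact ⟨fun ha _ => base 0 ha, fun _ hb => hr 0 hb⟩
    | succ b ih =>
      refine ⟨fun ha hb => ?_, fun _ hb => hr _ hb⟩
      rw [Hb_succ]
      exact (bck_inter (ih.1 ha (by omega)) (hr b (by omega))).2
  | succ a iha =>
    have hr : a + 1 ≤ r → ∀ b < q, Itl (Hb P Q r q (a+1) (b+1)) (Hb P Q r q (a+1) b) := by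
      intro ha b hb
      rw [Hb_succ]
      exact (bck_inter ((iha b).1 (by omega) (by omega)) ((iha b).2 (by omega) hb)).1
    intro b
    induction b with
    | zero => exact ⟨fun ha _ => base _ ha, fun ha hb => hr ha 0 hb⟩
    | succ b ih =>
      refine ⟨fun ha hb => ?_, fun ha hb => hr ha _ hb⟩
      rw [Hb_succ]
      exact (bck_inter (ih.1 ha (by omega)) (hr (by omega) b (by omega))).2

theorem MSet_card {N k r q : ℕ} {A B : ℕ → ℕ} (hrN : r ≤ N) :
    (MSet k r q A B).ncard = (CSet N k r q A B).ncard := by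
  apply Set.ncard_congr (fun m _ =>
    ((fun i => if i ≤ r then G m i q else 0), (fun j => if j ≤ q then G m r j else 0)))
  · rintro m ⟨h0, h1, h2, h3⟩
    refine ⟨⟨?_, ?_, ?_, ?_⟩, ⟨?_, ?_, ?_, ?_⟩, ?_, ?_⟩
    · simp [G_zero_left]
    · intro j hj
      simp only [show j ≤ r by omega, show j + 1 ≤ r by omega, if_true]
      exact (G_inter m j q).1
    · intro j hj
      simp only [hj, if_true]
      rw [G_sum m N j (by omega)]
      apply sum_congr rfl
      intro i hi
      exact h1 i (by simp at hi; omega)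
    · intro j hj
      simp [show ¬ j ≤ r by omega]
    · simp [G_zero_right]
    · intro j hj
      simp only [show j ≤ q by omega, show j + 1 ≤ q by omega, if_true]
      exact (G_inter m r j).2
    · intro j hj
      simp only [hj, if_true]
      rw [G_sum m N r (by omega), sum_comm]
      apply sum_congr rfl
      intro i hi
      exact h2 i (by simp at hi; omega)
    · intro j hj
      simp [show ¬ j ≤ q by omega]
    · simp
    · simpa using h3
  · rintro m m' ⟨h0, -⟩ ⟨h0', -⟩ heq
    simp only [Prod.mk.injEq] at heq
    obtain ⟨e1, e2⟩ := heq
    have key : ∀ a ≤ r, ∀ b ≤ q, G m (r - a) (q - b) = G m' (r - a) (q - b) := by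
      intro a
      induction a with
      | zero =>
        intro _ b _
        have := congrFun e2 (q - b)
        simpa using this
      | succ a iha =>
        intro ha b
        induction b with
        | zero =>
          intro _
          have := congrFun e1 (r - (a+1))
          simpa using this
        | succ b ihb =>
          intro hb
          have x1 := iha (by omega) b (by omega)
          have x2 := iha (by omega) (b+1) (by omega)
          have x3 := ihb (by omega)
          obtain ⟨i, hi⟩ : ∃ i, r - (a+1) = i := ⟨_, rfl⟩
          obtain ⟨j, hj⟩ : ∃ j, q - (b+1) = j := ⟨_, rfl⟩
          rw [show r - a = i + 1 by omega, show q - b = j + 1 by omega] at x1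
          rw [show r - a = i + 1 by omega, hj] at x2
          rw [hi, show q - b = j + 1 by omega] at x3
          rw [hi, hj]
          rw [← bck_stp (m i j) (G_inter m i j).2 (G_inter m i j).1,
            ← bck_stp (m' i j) (G_inter m' i j).2 (G_inter m' i j).1, ← G_succ, ← G_succ, x1, x2, x3]
    funext i j
    by_cases hij : i < r ∧ j < q
    · have x1 := key (r - (i+1)) (by omega) (q - (j+1)) (by omega)
      have x2 := key (r - i) (by omega) (q - (j+1)) (by omega)
      have x3 := key (r - (i+1)) (by omega) (q - j) (by omega)
      rw [show r - (r - (i+1)) = i + 1 by omega, show q - (q - (j+1)) = j + 1 by omega] at x1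
      rw [show r - (r - i) = i by omega, show q - (q - (j+1)) = j + 1 by omega] at x2
      rw [show r - (r - (i+1)) = i + 1 by omega, show q - (q - j) = j by omega] at x3
      have y := congrFun x1 0
      rw [G_succ, G_succ, x2, x3] at y
      simpa [stp] using y
    · rw [h0 i j hij, h0' i j hij]
  · rintro ⟨P, Q⟩ ⟨⟨p0, p1, p2, p3⟩, ⟨q0, q1, q2, q3⟩, hPQ, hk⟩
    dsimp only at *
    have hI := Hb_inter hPQ p1 q1
    set H := Hb P Q r q with hH
    have z1 : ∀ b ≤ q, H r b = 0 := by
      intro b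
      induction b with
      | zero => intro _; rw [hH, Hb_right _ _ _ _ _ hPQ]; simpa using p0
      | succ b ih =>
        intro hb
        have := (hI r b).2 le_rfl (by omega)
        rw [ih (by omega)] at this
        exact inter_zero' this
    have z2 : ∀ a ≤ r, H a q = 0 := by
      intro b
      induction b with
      | zero => intro _; rw [hH, Hb_left]; simpa using q0
      | succ b ih =>
        intro hb
        have := (hI b q).1 (by omega) le_rfl
        rw [ih (by omega)] at this
        exact inter_zero' this
    let m : ℕ → ℕ → ℕ := fun i j => if i < r ∧ j < q then
      H (r - (i+1)) (q - (j+1)) 0 - max (H (r - i) (q - (j+1)) 0) (H (r - (i+1)) (q - j) 0) else 0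
    have key : ∀ i ≤ r, ∀ j ≤ q, G m i j = H (r - i) (q - j) := by
      intro i
      induction i with
      | zero => intro _ j hj; rw [G_zero_left, Nat.sub_zero, z1 _ (by omega)]
      | succ i ihi =>
        intro hi j
        induction j with
        | zero => intro _; rw [G_zero_right, Nat.sub_zero, z2 _ (by omega)]
        | succ j ihj =>
          intro hj
          rw [G_succ, ihi (by omega) _ hj, ihi (by omega) _ (by omega), ihj (by omega)]
          have hm : m i j = H (r - (i+1)) (q - (j+1)) 0 - max (H (r - i) (q - (j+1)) 0) (H (r - (i+1)) (q - j) 0) := by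
            simp only [m]; rw [if_pos ⟨by omega, by omega⟩]
          rw [hm]
          obtain ⟨a, ha⟩ : ∃ a, r - (i+1) = a := ⟨_, rfl⟩
          obtain ⟨b, hb⟩ : ∃ b, q - (j+1) = b := ⟨_, rfl⟩
          rw [show r - i = a + 1 by omega, show q - j = b + 1 by omega, ha, hb]
          conv_lhs => rw [hH, Hb_succ, ← hH]
          exact stp_bck ((hI a b).1 (by omega) (by omega)) ((hI a b).2 (by omega) (by omega))
    have hGP : ∀ i ≤ r, G m i q = P i := by
      intro i hi
      rw [key i hi q le_rfl, Nat.sub_self, hH, Hb_right _ _ _ _ _ hPQ]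
      congr 1; omega
    have hGQ : ∀ j ≤ q, G m r j = Q j := by
      intro i hi
      rw [key r le_rfl i hi, Nat.sub_self, hH, Hb_left]
      congr 1; omega
    refine ⟨m, ⟨?_, ?_, ?_, ?_⟩, ?_⟩
    · intro i j h; simp only [m]; rw [if_neg h]
    · intro i hi
      have x1 := p2 (i+1) hi
      have x2 := p2 i (by omega)
      rw [← hGP _ hi, G_sum _ _ _ (by omega), sum_range_succ, ← G_sum m N i (by omega),
        hGP _ (by omega), x2, off_succ] at x1
      omega
    · intro i hi
      have x1 := q2 (i+1) hi
      have x2 := q2 i (by omega)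
      rw [← hGQ _ hi, G_sum _ _ _ (by omega), sum_comm, sum_range_succ, sum_comm, ← G_sum m N r (by omega),
        hGQ _ (by omega), x2, off_succ] at x1
      omega
    · rw [hGP r le_rfl]; exact hk
    · refine Prod.ext ?_ ?_
      · funext i
        dsimp only
        split_ifs with h
        · exact hGP i h
        · rw [p3 i (by omega)]
      · funext i
        dsimp only
        split_ifs with h
        · exact hGQ i h
        · rw [q3 i (by omega)]

/-! standardization -/

lemma mem_downset {s : Finset ℕ} (h : ∀ a ∈ s, ∀ b ≤ a, b ∈ s) (b : ℕ) : b ∈ s ↔ b < #s := by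
  constructor
  · intro hb
    have : range (b+1) ⊆ s := fun x hx => h b hb x (by simp at hx; omega)
    have := card_le_card this
    simp at this; omega
  · intro hb
    by_contra hn
    have : s ⊆ range b := by
      intro x hx
      by_contra hx'
      exact hn (h x hx b (by simpa using hx'))
    have := card_le_card this
    simp at this; omega

lemma exists_block (A : ℕ → ℕ) (r y : ℕ) (h0 : 0 < y) (h : y ≤ off A r) :
    ∃ j < r, off A j < y ∧ y ≤ off A (j+1) := by
  induction r with
  | zero => rw [off_zero] at h; omega
  | succ r ih =>
    by_cases hy : y ≤ off A r
    · obtain ⟨j, h1, h2⟩ := ih hy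
      exact ⟨j, by omega, h2⟩
    · exact ⟨r, by omega, by omega, h⟩

lemma std_rank {α : Type*} {X : Finset α} {e : α → ℕ} {l : ℕ} (hi : Set.InjOn e X)
    (him : X.image e = Icc 1 l) {n : ℕ} (hn : n ≤ l) : #{y ∈ X | e y ≤ n} = n := by
  have h1 : #({y ∈ X | e y ≤ n}.image e) = #{y ∈ X | e y ≤ n} :=
    card_image_of_injOn (hi.mono (by intro x hx; simp at hx; exact hx.1))
  rw [← h1]
  have : {y ∈ X | e y ≤ n}.image e = Icc 1 n := by
    ext z
    simp only [mem_image, mem_filter, mem_Icc]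
    constructor
    · rintro ⟨y, ⟨hy, hyn⟩, rfl⟩
      have : e y ∈ Icc 1 l := by rw [← him]; exact mem_image_of_mem _ hy
      simp at this; omega
    · rintro ⟨h1, h2⟩
      have : z ∈ X.image e := by rw [him]; simp; omega
      obtain ⟨y, hy, rfl⟩ := mem_image.1 this
      exact ⟨y, ⟨hy, h2⟩, rfl⟩
  rw [this]; simp

lemma std_unique {α : Type*} {X : Finset α} {e e' : α → ℕ} {l : ℕ}
    (hi : Set.InjOn e X) (him : X.image e = Icc 1 l)
    (hi' : Set.InjOn e' X) (him' : X.image e' = Icc 1 l)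
    (ho : ∀ x ∈ X, ∀ y ∈ X, e x < e y → e' x < e' y) : ∀ x ∈ X, e x = e' x := by
  intro x hx
  have m1 : e x ∈ Icc 1 l := by rw [← him]; exact mem_image_of_mem _ hx
  have m2 : e' x ∈ Icc 1 l := by rw [← him']; exact mem_image_of_mem _ hx
  simp at m1 m2
  rw [← std_rank hi him m1.2, ← std_rank hi' him' m2.2]
  congr 1
  apply filter_congr
  intro y hy
  constructor
  · intro h
    rcases h.lt_or_eq with h | h
    · exact (ho y hy x hx h).le
    · rw [hi hy hx h]
  · intro h
    by_contra hn
    have := ho x hx y hy (by omega)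
    omega

lemma std_exists {α : Type*} (X : Finset α) (f h : α → ℕ)
    (hinj : ∀ x ∈ X, ∀ y ∈ X, f x = f y → h x = h y → x = y) :
    ∃ e : α → ℕ, Set.InjOn e X ∧ X.image e = Icc 1 #X ∧
      (∀ x ∈ X, ∀ y ∈ X, (f x < f y ∨ (f x = f y ∧ h x < h y)) → e x < e y) ∧
      (∀ x ∈ X, ∀ j, e x ≤ #{y ∈ X | f y < j} ↔ f x < j) := by
  classical
  let e : α → ℕ := fun x => #{y ∈ X | f y < f x ∨ (f y = f x ∧ h y ≤ h x)}
  have hlt : ∀ x ∈ X, ∀ y ∈ X, (f x < f y ∨ (f x = f y ∧ h x < h y)) → e x < e y := by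
    intro x hx y hy hxy
    apply card_lt_card
    rw [ssubset_iff_of_subset]
    · refine ⟨y, by simp [hy], ?_⟩
      simp only [mem_filter]; omega
    · intro z hz
      simp only [mem_filter] at hz ⊢
      refine ⟨hz.1, ?_⟩; omega
  have hi : Set.InjOn e X := by
    intro x hx y hy hxy
    apply hinj x hx y hy
    · by_contra hne
      rcases Nat.lt_or_gt_of_ne hne with h1 | h1
      · have := hlt x hx y hy (Or.inl h1); omega
      · have := hlt y hy x hx (Or.inl h1); omega
    · by_contra hne
      have := hlt x hx y hy
      have := hlt y hy x hx
      omega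
  refine ⟨e, hi, ?_, hlt, ?_⟩
  · apply eq_of_subset_of_card_le
    · intro z hz
      obtain ⟨x, hx, rfl⟩ := mem_image.1 hz
      simp only [mem_Icc]
      refine ⟨card_pos.2 ⟨x, by simp [hx]⟩, card_le_card (filter_subset _ _)⟩
    · rw [card_image_of_injOn hi]; simp
  · intro x hx j
    constructor
    · intro hle
      by_contra hn
      have : #{y ∈ X | f y < j} < e x := by
        apply card_lt_card
        rw [ssubset_iff_of_subset]
        · refine ⟨x, by simp [hx], ?_⟩
          simp only [mem_filter]; omega
        · intro z hz
          simp only [mem_filter] at hz ⊢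
          refine ⟨hz.1, ?_⟩; omega
      omega
    · intro hlt
      apply card_le_card
      intro z hz
      simp only [mem_filter] at hz ⊢
      refine ⟨hz.1, ?_⟩; omega

lemma cols_sum (μ : YoungDiagram) (N : ℕ) (hN : ∀ c, N ≤ c → μ.colLen c = 0) (p : ℕ → ℕ → Prop)
    [∀ i c, Decidable (p i c)] :
    ∑ c ∈ range N, #{i ∈ range (μ.colLen c) | p i c} = #{x ∈ μ.cells | p x.1 x.2} := by
  rw [card_eq_sum_card_fiberwise (f := Prod.snd) (t := range N)]
  · apply sum_congr rfl
    intro c _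
    apply card_bij (fun i _ => (i, c))
    · intro i hi
      simp only [mem_filter, mem_range, ← YoungDiagram.mem_iff_lt_colLen] at hi
      simp [hi.1, hi.2]
    · intro a _ b _ h
      simpa using h
    · rintro ⟨i, c'⟩ hx
      simp only [mem_filter, YoungDiagram.mem_cells] at hx
      obtain ⟨⟨h1, h2⟩, rfl⟩ := hx
      refine ⟨i, ?_, rfl⟩
      simp only [mem_filter, mem_range, ← YoungDiagram.mem_iff_lt_colLen]
      exact ⟨h1, h2⟩
  · rintro ⟨i, c⟩ hx
    simp only [coe_filter, YoungDiagram.mem_cells, Set.mem_ofPred_eq] at hx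
    simp only [coe_range, Set.mem_Iio]
    by_contra hn
    have := hN c (by omega)
    have h2 := YoungDiagram.mem_iff_lt_colLen.1 hx.1
    omega

def PT (μ : YoungDiagram) (M : ℕ → ℕ → ℕ) (A : ℕ → ℕ) (r : ℕ) : ℕ → ℕ → ℕ := fun j c =>
  if j ≤ r then #{i ∈ range (μ.colLen c) | M i c ≤ off A j} else 0

lemma syt_bd {μ : YoungDiagram} {M : ℕ → ℕ → ℕ} (h : IsSYT μ M) {i c : ℕ} (hx : (i, c) ∈ μ) :
    1 ≤ M i c ∧ M i c ≤ μ.card := by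
  obtain ⟨h1, h2, h3, h4, h5⟩ := h
  have : M i c ∈ μ.cells.image (fun c => M c.1 c.2) :=
    mem_image.2 ⟨(i, c), by simpa using hx, rfl⟩
  rw [h4] at this
  simpa using this

lemma PT_lt {μ : YoungDiagram} {M : ℕ → ℕ → ℕ} (h : IsSYT μ M) {A : ℕ → ℕ} {r j : ℕ} (hj : j ≤ r)
    {i c : ℕ} (hx : (i, c) ∈ μ) : M i c ≤ off A j ↔ i < PT μ M A r j c := by
  simp only [PT, if_pos hj]
  rw [← mem_downset]
  · simp only [mem_filter, mem_range, ← YoungDiagram.mem_iff_lt_colLen]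
    simp [hx]
  · intro a ha b hb
    simp only [mem_filter, mem_range, ← YoungDiagram.mem_iff_lt_colLen] at ha ⊢
    refine ⟨μ.up_left_mem hb le_rfl ha.1, ?_⟩
    rcases hb.lt_or_eq with hb | hb
    · have := h.2.1 b a c hb ha.1
      omega
    · subst hb; exact ha.2

lemma PT_top {μ : YoungDiagram} {M : ℕ → ℕ → ℕ} (h : IsSYT μ M) {A : ℕ → ℕ} {r : ℕ}
    (hA : off A r = μ.card) : PT μ M A r r = μ.colLen := by
  funext c
  simp only [PT, le_refl, if_true]
  rw [filter_true_of_mem, card_range]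
  intro i hi
  simp only [mem_range, ← YoungDiagram.mem_iff_lt_colLen] at hi
  rw [hA]; exact (syt_bd h hi).2

lemma PT_mem {μ : YoungDiagram} {M : ℕ → ℕ → ℕ} (h : IsSYT μ M) {A : ℕ → ℕ} {r N : ℕ}
    (hA : off A r = μ.card) (hB : BlockRowCond r A μ M) (hN : ∀ c, N ≤ c → μ.colLen c = 0) :
    PT μ M A r ∈ ChainS N r A := by
  refine ⟨?_, ?_, ?_, ?_⟩
  · funext c
    simp only [PT, Nat.zero_le, if_true, off_zero, Pi.zero_apply, card_eq_zero, filter_eq_empty_iff]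
    intro i hi
    simp only [mem_range, ← YoungDiagram.mem_iff_lt_colLen] at hi
    have := syt_bd h hi
    omega
  · intro j hj c
    simp only [PT, show j ≤ r by omega, show j + 1 ≤ r by omega, if_true]
    constructor
    · apply card_le_card
      intro i hi
      simp only [mem_filter] at hi ⊢
      have := off_mono A (Nat.le_succ j)
      refine ⟨hi.1, ?_⟩; simp only [Nat.succ_eq_add_one] at this; omega
    · apply card_le_card
      intro i hi
      simp only [mem_filter, mem_range, ← YoungDiagram.mem_iff_lt_colLen] at hi ⊢
      have hm : (i, c) ∈ μ := μ.up_left_mem le_rfl (Nat.le_succ c) hi.1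
      refine ⟨hm, ?_⟩
      by_contra hn
      have hlt := h.1 i c (c+1) (by omega) hi.1
      have := hB j hj (M i c) (by rw [mem_Block]; omega) (M i (c+1)) (by rw [mem_Block]; omega) hlt
        (i, c) (by simpa using hm) (i, c+1) (by simpa using hi.1) rfl rfl
      simp at this
  · intro j hj
    simp only [PT, hj, if_true]
    rw [cols_sum μ N hN (fun i c => M i c ≤ off A j)]
    exact std_rank (e := fun x : ℕ × ℕ => M x.1 x.2) h.2.2.2.2 h.2.2.2.1
      (by rw [← hA]; exact off_mono A hj)
  · intro j hj
    funext c
    simp [PT, show ¬ j ≤ r by omega]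

lemma PT_inj {μ : YoungDiagram} {M M' : ℕ → ℕ → ℕ} (h : IsSYT μ M) (h' : IsSYT μ M') {A : ℕ → ℕ} {r : ℕ}
    (hA : off A r = μ.card) (hB : BlockRowCond r A μ M) (hB' : BlockRowCond r A μ M')
    (he : PT μ M A r = PT μ M' A r) : M = M' := by
  have key : ∀ x ∈ μ.cells, (fun x : ℕ × ℕ => M x.1 x.2) x = (fun x : ℕ × ℕ => M' x.1 x.2) x := by
    apply std_unique h.2.2.2.2 h.2.2.2.1 h'.2.2.2.2 h'.2.2.2.1
    rintro ⟨i, c⟩ hx ⟨i', c'⟩ hy hlt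
    have hx' : (i, c) ∈ μ := by simpa using hx
    have hy' : (i', c') ∈ μ := by simpa using hy
    dsimp only at *
    have bx := syt_bd h hx'
    have bY := syt_bd h hy'
    obtain ⟨j, hj, j1, j2⟩ := exists_block A r (M i' c') (by omega) (by omega)
    have a1 := PT_lt h (A := A) (show j ≤ r by omega) hx'
    have a2 := PT_lt h (A := A) (show j ≤ r by omega) hy'
    have a3 := PT_lt h (A := A) (show j + 1 ≤ r by omega) hx'
    have a4 := PT_lt h (A := A) (show j + 1 ≤ r by omega) hy'
    rw [he] at a1 a2 a3 a4
    rw [← PT_lt h' (A := A) (show j ≤ r by omega) hx'] at a1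
    rw [← PT_lt h' (A := A) (show j ≤ r by omega) hy'] at a2
    rw [← PT_lt h' (A := A) (show j + 1 ≤ r by omega) hx'] at a3
    rw [← PT_lt h' (A := A) (show j + 1 ≤ r by omega) hy'] at a4
    by_cases hc : M i c ≤ off A j
    · have := a1.1 hc
      have : ¬ M' i' c' ≤ off A j := by rw [← a2]; omega
      omega
    · have b1 := hB j hj (M i c) (by rw [mem_Block]; omega) (M i' c') (by rw [mem_Block]; omega) hlt
        (i, c) hx (i', c') hy rfl rfl
      have c1 : ¬ M' i c ≤ off A j := by rw [← a1]; omega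
      have c2 : ¬ M' i' c' ≤ off A j := by rw [← a2]; omega
      have c3 := a3.1 (by omega)
      have c4 := a4.1 (by omega)
      by_contra hn
      rcases (not_lt.1 hn).lt_or_eq with hl | hl
      · have b2 := hB' j hj (M' i' c') (by rw [mem_Block]; omega) (M' i c) (by rw [mem_Block]; omega) hl
          (i', c') hy (i, c) hx rfl rfl
        dsimp only at b1 b2
        omega
      · have := h'.2.2.2.2 hx hy hl.symm
        rw [Prod.mk.injEq] at this
        obtain ⟨rfl, rfl⟩ := this
        omega
  funext i c
  by_cases hx : (i, c) ∈ μ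
  · exact key (i, c) (by simpa using hx)
  · rw [h.2.2.1 i c hx, h'.2.2.1 i c hx]

lemma chain_mono {r : ℕ} {P : ℕ → ℕ → ℕ}
    (h : ∀ j < r, Itl (P j) (P (j+1))) (c i : ℕ) : ∀ j ≤ r, i ≤ j → P i c ≤ P j c := by
  intro j
  induction j with
  | zero => intro _ h; obtain rfl : i = 0 := by omega
            exact le_rfl
  | succ j ih =>
    intro hj hi
    rcases hi.lt_or_eq with h1 | h1
    · exact (ih (by omega) (by omega)).trans (h j (by omega) c).1
    · rw [h1]

lemma chain_anti {r : ℕ} {P : ℕ → ℕ → ℕ} (h0 : P 0 = 0)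
    (h : ∀ j < r, Itl (P j) (P (j+1))) (j : ℕ) (hj : j ≤ r) : Antitone (P j) := by
  apply antitone_nat_of_succ_le
  intro c
  rcases j with _ | j
  · simp [h0]
  · have := h j (by omega) c
    omega

lemma PT_surj {μ : YoungDiagram} {A : ℕ → ℕ} {r N : ℕ} (hrN : r ≤ N)
    (hA : off A r = μ.card) {P : ℕ → ℕ → ℕ} (hP : P ∈ ChainS N r A) (hT : P r = μ.colLen) :
    ∃ M, IsSYT μ M ∧ BlockRowCond r A μ M ∧ PT μ M A r = P := by
  obtain ⟨p0, p1, p2, p3⟩ := hP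
  have hN : ∀ c, N ≤ c → μ.colLen c = 0 := by
    intro c hc
    rw [← hT]; exact chain_supp p0 p1 r le_rfl c (by omega)
  let f : ℕ × ℕ → ℕ := fun x => #{j ∈ range r | P (j+1) x.2 ≤ x.1}
  have hf : ∀ x : ℕ × ℕ, ∀ j ≤ r, f x < j ↔ x.1 < P j x.2 := by
    intro x j hj
    rcases j with _ | j
    · simp [p0]
    · have := mem_downset (s := {j ∈ range r | P (j+1) x.2 ≤ x.1}) (by
        intro a ha b hb
        simp only [mem_filter, mem_range] at ha ⊢
        have := chain_mono p1 x.2 (b+1) (a+1) (by omega) (by omega)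
        omega) j
      simp only [mem_filter, mem_range] at this
      simp only [f]
      omega
  have hfr : ∀ x ∈ μ.cells, f x < r := by
    rintro ⟨i, c⟩ hx
    rw [hf _ r le_rfl, hT]
    exact YoungDiagram.mem_iff_lt_colLen.1 (by simpa using hx)
  -- key facts
  have hrow : ∀ i c c', c < c' → (i, c') ∈ μ → f (i, c) < f (i, c') := by
    intro i c c' hc hx
    have h1 := hfr (i, c') (by simpa using hx)
    have h2 := (hf (i, c') (f (i, c') + 1) (by omega)).1 (by omega)
    rw [hf _ _ (by omega)]
    obtain ⟨d, rfl⟩ : ∃ d, c' = d + 1 := ⟨c' - 1, by omega⟩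
    have h3 := (p1 (f (i, d+1)) h1 d).2
    have h4 := chain_anti p0 p1 (f (i, d+1)) (by omega) (show c ≤ d by omega)
    dsimp only at *
    omega
  obtain ⟨e, e1, e2, e3, e4⟩ := std_exists μ.cells f Prod.fst (by
    rintro ⟨i, c⟩ hx ⟨i', c'⟩ hy h1 h2
    dsimp only at h2
    subst h2
    rcases lt_trichotomy c c' with h | h | h
    · have := hrow i c c' h (by simpa using hy); omega
    · rw [h]
    · have := hrow i c' c h (by simpa using hx); omega)
  have hcnt : ∀ j ≤ r, #{y ∈ μ.cells | f y < j} = off A j := by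
    intro j hj
    have : {y ∈ μ.cells | f y < j} = {y ∈ μ.cells | y.1 < P j y.2} := by
      apply filter_congr; intro y _; rw [hf _ _ hj]
    rw [this, ← cols_sum μ N hN (fun i c => i < P j c), ← p2 j hj]
    apply sum_congr rfl
    intro c _
    have hle : P j c ≤ μ.colLen c := by rw [← hT]; exact chain_mono p1 c j r le_rfl hj
    have : {i ∈ range (μ.colLen c) | i < P j c} = range (P j c) := by
      ext i; simp only [mem_filter, mem_range]; omega
    rw [this, card_range]
  let M : ℕ → ℕ → ℕ := fun i c => if (i, c) ∈ μ then e (i, c) else 0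
  have hM : ∀ x ∈ μ.cells, M x.1 x.2 = e x := by
    rintro ⟨i, c⟩ hx
    simp only [M]; rw [if_pos (by simpa using hx)]
  have hle : ∀ x ∈ μ.cells, ∀ j ≤ r, e x ≤ off A j ↔ f x < j := by
    intro x hx j hj
    rw [← hcnt j hj]; exact e4 x hx j
  have hpos : ∀ x ∈ μ.cells, 1 ≤ e x := by
    intro x hx
    have : e x ∈ Icc 1 #μ.cells := by rw [← e2]; exact mem_image_of_mem _ hx
    simp at this; omega
  refine ⟨M, ⟨?_, ?_, ?_, ?_, ?_⟩, ?_, ?_⟩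
  · intro i c c' hc hx
    have hx' : (i, c) ∈ μ := μ.up_left_mem le_rfl hc.le hx
    simp only [M, if_pos hx, if_pos hx']
    exact e3 _ (by simpa using hx') _ (by simpa using hx) (Or.inl (hrow i c c' hc hx))
  · intro i i' c hc hx
    have hx' : (i, c) ∈ μ := μ.up_left_mem hc.le le_rfl hx
    simp only [M, if_pos hx, if_pos hx']
    apply e3 _ (by simpa using hx') _ (by simpa using hx)
    have h1 := hfr (i', c) (by simpa using hx)
    have h2 := (hf (i', c) (f (i', c) + 1) (by omega)).1 (by omega)
    have h3 := (hf (i, c) (f (i', c) + 1) (by omega)).2 (by dsimp only at *; omega)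
    dsimp only
    omega
  · intro i c hx
    simp only [M, if_neg hx]
  · rw [image_congr (g := e)]
    · exact e2
    · intro x hx; exact hM x hx
  · intro x hx y hy hxy
    dsimp only at hxy
    rw [hM x hx, hM y hy] at hxy
    exact e1 hx hy hxy
  · intro j hj m₁ hm₁ m₂ hm₂ hlt x hx y hy h1 h2
    rw [hM x hx] at h1
    rw [hM y hy] at h2
    subst h1 h2
    rw [mem_Block] at hm₁ hm₂
    have a1 := hle x hx j (by omega)
    have a2 := hle x hx (j+1) (by omega)
    have a3 := hle y hy j (by omega)
    have a4 := hle y hy (j+1) (by omega)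
    have hfe : f x = f y := by omega
    by_contra hn
    rcases (not_lt.1 hn).lt_or_eq with hl | hl
    · have := e3 y hy x hx (Or.inr ⟨hfe.symm, hl⟩)
      omega
    · obtain ⟨i, c⟩ := x
      obtain ⟨i', c'⟩ := y
      dsimp only at hl
      subst hl
      rcases lt_trichotomy c c' with h | h | h
      · have := hrow _ c c' h (by simpa using hy); omega
      · subst h; omega
      · have := hrow _ c' c h (by simpa using hx); omega
  · funext j c
    simp only [PT]
    split_ifs with hj
    · have hle2 : P j c ≤ μ.colLen c := by rw [← hT]; exact chain_mono p1 c j r le_rfl hj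
      have : {i ∈ range (μ.colLen c) | M i c ≤ off A j} = range (P j c) := by
        ext i
        simp only [mem_filter, mem_range]
        constructor
        · rintro ⟨h1, h2⟩
          have hx : (i, c) ∈ μ.cells := by simpa using YoungDiagram.mem_iff_lt_colLen.2 h1
          rw [hM (i, c) hx, hle _ hx j hj, hf _ _ hj] at h2
          exact h2
        · intro h1
          have hx : (i, c) ∈ μ.cells := by
            simpa using YoungDiagram.mem_iff_lt_colLen.2 (by omega : i < μ.colLen c)
          refine ⟨by omega, ?_⟩
          rw [hM (i, c) hx, hle _ hx j hj, hf _ _ hj]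
          exact h1
      rw [this, card_range]
    · rw [p3 j (by omega)]; rfl

lemma exists_diagram {g : ℕ → ℕ} (hg : Antitone g) {N : ℕ} (hN : ∀ c, N ≤ c → g c = 0) :
    ∃ μ : YoungDiagram, μ.colLen = g := by
  let μ : YoungDiagram := ⟨{x ∈ range (g 0) ×ˢ range N | x.1 < g x.2}, by
    rintro ⟨a, b⟩ ⟨c, d⟩ hle hx
    simp only [Prod.mk_le_mk] at hle
    simp only [coe_filter, mem_product, mem_range, Set.mem_ofPred_eq] at hx ⊢
    have := hg hle.2
    omega⟩
  refine ⟨μ, ?_⟩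
  have hm : ∀ i c, (i, c) ∈ μ ↔ i < g c := by
    intro i c
    rw [← YoungDiagram.mem_cells]
    simp only [μ, mem_filter, mem_product, mem_range]
    have := hg (Nat.zero_le c)
    have := hN c
    omega
  funext c
  apply eq_of_forall_lt_iff
  intro i
  rw [← YoungDiagram.mem_iff_lt_colLen, hm]

lemma card_eq_sum_colLen (μ : YoungDiagram) (N : ℕ) (hN : ∀ c, N ≤ c → μ.colLen c = 0) :
    μ.card = ∑ c ∈ range N, μ.colLen c := by
  have := cols_sum μ N hN (fun _ _ => True)
  simpa using this.symm

theorem S_card {l k r q N : ℕ} {A B : ℕ → ℕ} (hrN : r ≤ N) (hqN : q ≤ N)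
    (hA : off A r = l) (hB : off B q = l) :
    (SYTPairSet l k r q A B).ncard = (CSet N k r q A B).ncard := by
  apply Set.ncard_congr (fun x _ => (PT x.1 x.2.1 A r, PT x.1 x.2.2 B q))
  · rintro ⟨μ, M, M'⟩ ⟨h1, h2, h3, h4, h5, h6, h7⟩
    dsimp only at *
    have hN : ∀ c, N ≤ c → μ.colLen c = 0 := by
      intro c hc
      by_contra hn
      have : (0, c) ∈ μ := YoungDiagram.mem_iff_lt_colLen.2 (by omega)
      have := YoungDiagram.mem_iff_lt_rowLen.1 this
      omega
    have t1 := PT_top h4 (A := A) (r := r) (by omega)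
    have t2 := PT_top h5 (A := B) (r := q) (by omega)
    refine ⟨PT_mem h4 (by omega) h6 hN, PT_mem h5 (by omega) h7 hN, ?_, ?_⟩
    · dsimp only; rw [t1, t2]
    · dsimp only; rw [t1]; exact h2
  · rintro ⟨μ, M, M'⟩ ⟨ν, L, L'⟩ ⟨h1, h2, h3, h4, h5, h6, h7⟩ ⟨g1, g2, g3, g4, g5, g6, g7⟩ he
    dsimp only at *
    rw [Prod.mk.injEq] at he
    obtain ⟨e1, e2⟩ := he
    have t1 := PT_top h4 (A := A) (r := r) (by omega)
    have t2 := PT_top g4 (A := A) (r := r) (by omega)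
    have : μ = ν := by
      rw [e1, t2] at t1
      ext ⟨i, c⟩
      rw [YoungDiagram.mem_cells, YoungDiagram.mem_cells, YoungDiagram.mem_iff_lt_colLen,
        YoungDiagram.mem_iff_lt_colLen, t1]
    subst this
    rw [PT_inj h4 g4 (by omega) h6 g6 e1, PT_inj h5 g5 (by omega) h7 g7 e2]
  · rintro ⟨P, Q⟩ ⟨hP, hQ, hPQ, hk⟩
    dsimp only at *
    have sP := chain_supp hP.1 hP.2.1 r le_rfl
    have sQ := chain_supp hQ.1 hQ.2.1 q le_rfl
    obtain ⟨μ, hμ⟩ := exists_diagram (chain_anti hP.1 hP.2.1 r le_rfl) (N := r) sP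
    have hcard : μ.card = l := by
      rw [card_eq_sum_colLen μ N (by intro c hc; rw [hμ]; exact sP c (by omega)), hμ, hP.2.2.1 r le_rfl, hA]
    obtain ⟨M, m1, m2, m3⟩ := PT_surj (μ := μ) hrN (by omega) hP hμ.symm
    obtain ⟨L, l1, l2, l3⟩ := PT_surj (μ := μ) hqN (by omega) hQ (by rw [hμ, hPQ])
    refine ⟨(μ, M, L), ⟨hcard, ?_, ?_, m1, l1, m2, l2⟩, ?_⟩
    · dsimp only; rw [hμ]; exact hk
    · dsimp only
      by_contra hn
      have h1 : (0, min r q) ∈ μ := YoungDiagram.mem_iff_lt_rowLen.2 (by omega)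
      have h2 := YoungDiagram.mem_iff_lt_colLen.1 h1
      rw [hμ] at h2
      rcases le_total r q with h | h
      · rw [min_eq_left h, sP r le_rfl] at h2; omega
      · rw [min_eq_right h, hPQ, sQ q le_rfl] at h2; omega
    · dsimp only; rw [m3, l3]

/-! permutations and matrices -/

def VSet (l k r q : ℕ) (A B : ℕ → ℕ) : Set (ℕ → ℕ) :=
  {v | Set.BijOn v (Set.Icc 1 l) (Set.Icc 1 l) ∧ (∀ m, m ∉ Set.Icc 1 l → v m = m) ∧
    (∀ s : Finset ℕ, s ⊆ Icc 1 l → StrictMonoOn v s → #s ≤ k) ∧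
    (∀ j < r, ∀ p₁ ∈ Icc 1 l, ∀ p₂ ∈ Icc 1 l, p₁ < p₂ → v p₁ ∈ Block A j → v p₂ ∈ Block A j →
      v p₁ < v p₂) ∧
    (∀ j < q, ∀ p₁ ∈ Block B j, ∀ p₂ ∈ Block B j, p₁ < p₂ → v p₁ < v p₂)}

def mat (v A B : ℕ → ℕ) (r q : ℕ) : ℕ → ℕ → ℕ := fun i j =>
  if i < r ∧ j < q then #{p ∈ Block B j | v p ∈ Block A i} else 0

lemma block_unique {B : ℕ → ℕ} {j j' p : ℕ} (h : p ∈ Block B j) (h' : p ∈ Block B j') : j = j' := by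
  rw [mem_Block] at h h'
  by_contra hne
  rcases Nat.lt_or_gt_of_ne hne with h1 | h1
  · have := off_mono B (show j + 1 ≤ j' by omega); omega
  · have := off_mono B (show j' + 1 ≤ j by omega); omega

lemma block_card (B : ℕ → ℕ) (j : ℕ) : #(Block B j) = B j := by
  have := off_succ B j
  simp only [off] at this
  simp only [Block, Nat.card_Ioc]; omega

lemma block_sub {B : ℕ → ℕ} {q l j p : ℕ} (hB : off B q = l) (hj : j < q) (hp : p ∈ Block B j) :
    1 ≤ p ∧ p ≤ l := by
  rw [mem_Block] at hp
  have := off_mono B (show j + 1 ≤ q by omega)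
  omega

lemma blocks_sum (B : ℕ → ℕ) (q : ℕ) (P : ℕ → Prop) [DecidablePred P] :
    ∑ j ∈ range q, #{p ∈ Block B j | P p} = #{p ∈ Icc 1 (off B q) | P p} := by
  induction q with
  | zero => simp [off_zero]
  | succ q ih =>
    rw [sum_range_succ, ih, ← card_union_of_disjoint]
    · congr 1
      ext p
      have := off_mono B (Nat.le_succ q)
      simp only [Nat.succ_eq_add_one] at this
      simp only [mem_union, mem_filter, mem_Icc, mem_Block, ← or_and_right]
      refine and_congr_left (fun _ => ?_)
      omega
    · rw [disjoint_left]
      intro p h1 h2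
      simp only [mem_filter, mem_Icc, mem_Block] at h1 h2
      omega

lemma mat_cum {l r q : ℕ} {v A B : ℕ → ℕ} (hB : off B q = l)
    (hv : ∀ p, 1 ≤ p → p ≤ l → 1 ≤ v p) {j : ℕ} (hj : j < q) :
    ∀ i ≤ r, ∑ i' ∈ range i, mat v A B r q i' j = #{p ∈ Block B j | v p ≤ off A i} := by
  intro i
  induction i with
  | zero =>
    intro _
    simp only [range_zero, sum_empty, off_zero]
    symm
    rw [card_eq_zero, filter_eq_empty_iff]
    intro p hp
    have := block_sub hB hj hp
    have := hv p this.1 this.2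
    omega
  | succ i ih =>
    intro hi
    rw [sum_range_succ, ih (by omega)]
    simp only [mat, show i < r ∧ j < q from ⟨by omega, hj⟩, and_self, if_true]
    rw [← card_union_of_disjoint]
    · congr 1
      ext p
      have := off_mono A (Nat.le_succ i)
      simp only [Nat.succ_eq_add_one] at this
      simp only [mem_union, mem_filter, mem_Block A, ← and_or_left]
      refine and_congr_right (fun _ => ?_)
      omega
    · rw [disjoint_left]
      intro p h1 h2
      simp only [mem_filter, mem_Block A] at h1 h2
      omega

lemma lpp_le {l r q : ℕ} {v A B : ℕ → ℕ}
    (hpos : ∀ p ∈ Icc 1 l, 1 ≤ v p) (i : ℕ) : i ≤ r → ∀ j ≤ q, ∀ s ⊆ Icc 1 l, StrictMonoOn v s →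
      (∀ p ∈ s, p ≤ off B j ∧ v p ≤ off A i) → #s ≤ G (mat v A B r q) i j 0 := by
  induction i with
  | zero =>
    intro _ j _ s hs _ h
    have : s = ∅ := by
      rw [eq_empty_iff_forall_notMem]
      intro p hp
      have h1 := (h p hp).2
      have h2 := hpos p (hs hp)
      rw [off_zero] at h1; omega
    simp [this]
  | succ i ihi =>
    intro hi j
    induction j with
    | zero =>
      intro _ s hs _ h
      have : s = ∅ := by
        rw [eq_empty_iff_forall_notMem]
        intro p hp
        have h1 := (h p hp).1
        have h2 := hs hp
        rw [off_zero] at h1; simp at h2; omega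
      simp [this]
    | succ j ihj =>
      intro hj s hs hm h
      rw [G_succ]
      simp only [stp]
      set C := {p ∈ Block B j | v p ∈ Block A i} with hC
      have hmC : mat v A B r q i j = #C := by
        simp only [mat]; rw [if_pos ⟨by omega, by omega⟩]
      have hsplit : #s = #{p ∈ s | p ∈ C} + #{p ∈ s | p ∉ C} :=
        (card_filter_add_card_filter_not (s := s) (fun p => p ∈ C)).symm
      have h1 : #{p ∈ s | p ∈ C} ≤ #C := card_le_card (fun p hp => (mem_filter.1 hp).2)
      have hsub : {p ∈ s | p ∉ C} ⊆ s := filter_subset _ _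
      have hm' : StrictMonoOn v ({p ∈ s | p ∉ C} : Finset ℕ) := hm.mono (by exact_mod_cast hsub)
      have hnc : ∀ p ∈ ({p ∈ s | p ∉ C} : Finset ℕ), p ≤ off B j ∨ v p ≤ off A i := by
        intro p hp
        simp only [mem_filter, hC, mem_Block] at hp
        have := h p hp.1
        omega
      by_cases hall : ∀ p ∈ ({p ∈ s | p ∉ C} : Finset ℕ), v p ≤ off A i
      · have := ihi (by omega) (j+1) hj _ (hsub.trans hs) hm' (fun p hp => ⟨(h p (hsub hp)).1, hall p hp⟩)
        omega
      · have : ∀ p ∈ ({p ∈ s | p ∉ C} : Finset ℕ), p ≤ off B j := by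
          push Not at hall
          obtain ⟨x, hx, hx2⟩ := hall
          intro y hy
          by_contra hn
          have a1 := hnc x hx
          have a2 := hnc y hy
          have := hm' (by exact_mod_cast hx) (by exact_mod_cast hy) (show x < y by omega)
          omega
        have := ihj (by omega) _ (hsub.trans hs) hm' (fun p hp => ⟨this p hp, (h p (hsub hp)).2⟩)
        omega

lemma lpp_ge {l r q : ℕ} {v A B : ℕ → ℕ} (hB : off B q = l)
    (h4 : ∀ j < r, ∀ p₁ ∈ Icc 1 l, ∀ p₂ ∈ Icc 1 l, p₁ < p₂ → v p₁ ∈ Block A j → v p₂ ∈ Block A j →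
      v p₁ < v p₂)
    (h5 : ∀ j < q, ∀ p₁ ∈ Block B j, ∀ p₂ ∈ Block B j, p₁ < p₂ → v p₁ < v p₂)
    (i : ℕ) : i ≤ r → ∀ j ≤ q, ∃ s ⊆ Icc 1 l, StrictMonoOn v s ∧
      (∀ p ∈ s, p ≤ off B j ∧ v p ≤ off A i) ∧ #s = G (mat v A B r q) i j 0 := by
  induction i with
  | zero =>
    intro _ j _
    exact ⟨∅, by simp, (by intro x hx; simp at hx), by simp, by simp [G_zero_left]⟩
  | succ i ihi =>
    intro hi j
    induction j with
    | zero => intro _; exact ⟨∅, by simp, (by intro x hx; simp at hx), by simp, by simp [G_zero_right]⟩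
    | succ j ihj =>
      intro hj
      rw [G_succ]
      simp only [stp]
      set C := {p ∈ Block B j | v p ∈ Block A i} with hC
      have hmC : mat v A B r q i j = #C := by
        simp only [mat]; rw [if_pos ⟨by omega, by omega⟩]
      have hCm : ∀ p ∈ C, p ∈ Block B j ∧ off B j < p ∧ p ≤ off B (j+1) ∧ off A i < v p ∧ v p ≤ off A (i+1) ∧
          v p ∈ Block A i ∧ p ∈ Icc 1 l := by
        intro p hp
        have hp' := hp
        simp only [hC, mem_filter] at hp'
        have := block_sub hB (by omega) hp'.1
        have h1 := hp'.1
        have h2 := hp'.2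
        rw [mem_Block] at h1 h2
        exact ⟨hp'.1, h1.1, h1.2, h2.1, h2.2, hp'.2, by simp; omega⟩
      have hCl : C ⊆ Icc 1 l := fun p hp => (hCm p hp).2.2.2.2.2.2
      have ma := off_mono A (Nat.le_succ i)
      have mb := off_mono B (Nat.le_succ j)
      simp only [Nat.succ_eq_add_one] at ma mb
      have fin : ∀ s ⊆ Icc 1 l, StrictMonoOn v s → (∀ p ∈ s, p ≤ off B (j+1) ∧ v p ≤ off A (i+1)) →
          Disjoint s C →
          (∀ x ∈ s, ∀ y ∈ C, (x < y → v x < v y) ∧ (y < x → v y < v x)) →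
          ∃ t ⊆ Icc 1 l, StrictMonoOn v t ∧
            (∀ p ∈ t, p ≤ off B (j+1) ∧ v p ≤ off A (i+1)) ∧ #t = #s + #C := by
        intro s s1 s2 s3 s4 s5
        refine ⟨s ∪ C, union_subset s1 hCl, ?_, ?_, card_union_of_disjoint s4⟩
        · intro x hx y hy hxy
          simp only [coe_union, Set.mem_union, mem_coe] at hx hy
          rcases hx with hx | hx <;> rcases hy with hy | hy
          · exact s2 hx hy hxy
          · exact (s5 x hx y hy).1 hxy
          · exact (s5 y hy x hx).2 hxy
          · exact h5 j (by omega) x (hCm x hx).1 y (hCm y hy).1 hxy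
        · intro p hp
          rcases mem_union.1 hp with hp | hp
          · exact s3 p hp
          · exact ⟨(hCm p hp).2.2.1, (hCm p hp).2.2.2.2.1⟩
      rw [hmC]
      rcases le_total (G (mat v A B r q) i (j+1) 0) (G (mat v A B r q) (i+1) j 0) with hle | hle
      · obtain ⟨s, s1, s2, s3, s4⟩ := ihj (by omega)
        rw [max_eq_right hle, ← s4]
        apply fin s s1 s2 (fun p hp => by have := s3 p hp; omega)
        · rw [disjoint_left]
          intro p hp hp'
          have := s3 p hp
          have := hCm p hp'
          omega
        · intro x hx y hy
          have a := s3 x hx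
          have b := hCm y hy
          refine ⟨fun hxy => ?_, fun hxy => by omega⟩
          by_cases hv : v x ≤ off A i
          · omega
          · exact h4 i (by omega) x (s1 hx) y b.2.2.2.2.2.2 hxy (by rw [mem_Block]; omega) b.2.2.2.2.2.1
      · obtain ⟨s, s1, s2, s3, s4⟩ := ihi (by omega) (j+1) hj
        rw [max_eq_left hle, ← s4]
        apply fin s s1 s2 (fun p hp => by have := s3 p hp; omega)
        · rw [disjoint_left]
          intro p hp hp'
          have := s3 p hp
          have := hCm p hp'
          omega
        · intro x hx y hy
          have a := s3 x hx
          have b := hCm y hy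
          refine ⟨fun hxy => by omega, fun hxy => ?_⟩
          exact h5 j (by omega) y b.1 x (by rw [mem_Block]; omega) hxy

lemma block_seg {v B : ℕ → ℕ} {j : ℕ} (h5 : ∀ p₁ ∈ Block B j, ∀ p₂ ∈ Block B j, p₁ < p₂ → v p₁ < v p₂)
    (t : ℕ) {p : ℕ} (hp : p ∈ Block B j) :
    v p ≤ t ↔ p - off B j ≤ #{p' ∈ Block B j | v p' ≤ t} := by
  have hp' := hp
  rw [mem_Block] at hp'
  constructor
  · intro h
    have : Ioc (off B j) p ⊆ {p' ∈ Block B j | v p' ≤ t} := by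
      intro x hx
      simp only [mem_Ioc] at hx
      have hxb : x ∈ Block B j := by rw [mem_Block]; omega
      simp only [mem_filter]
      refine ⟨hxb, ?_⟩
      rcases hx.2.lt_or_eq with h1 | h1
      · have := h5 x hxb p hp h1; omega
      · rw [h1]; exact h
    have := card_le_card this
    simpa using this
  · intro h
    by_contra hn
    have : {p' ∈ Block B j | v p' ≤ t} ⊆ Ioc (off B j) (p-1) := by
      intro x hx
      simp only [mem_filter] at hx
      have hxb := hx.1
      rw [mem_Block] at hxb
      simp only [mem_Ioc]
      refine ⟨hxb.1, ?_⟩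
      by_contra hx2
      rcases (show p ≤ x by omega).lt_or_eq with h1 | h1
      · have := h5 p hp x hx.1 h1; omega
      · subst h1; omega
    have := card_le_card this
    simp only [Nat.card_Ioc] at this
    omega

theorem V_card {l k r q : ℕ} {A B : ℕ → ℕ} (hA : off A r = l) (hB : off B q = l) :
    (VSet l k r q A B).ncard = (MSet k r q A B).ncard := by
  apply Set.ncard_congr (fun v _ => mat v A B r q)
  · rintro v ⟨h1, h2, h3, h4, h5⟩
    have hmap : ∀ p ∈ Icc 1 l, 1 ≤ v p ∧ v p ≤ l := by
      intro p hp
      have := h1.mapsTo (show p ∈ Set.Icc 1 l by simpa using hp)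
      simpa using this
    refine ⟨?_, ?_, ?_, ?_⟩
    · intro i j hij; simp only [mat]; rw [if_neg hij]
    · intro i hi
      have : ∑ j ∈ range q, mat v A B r q i j = ∑ j ∈ range q, #{p ∈ Block B j | v p ∈ Block A i} := by
        apply sum_congr rfl
        intro j hj
        simp only [mem_range] at hj
        simp only [mat]; rw [if_pos ⟨hi, hj⟩]
      rw [this, blocks_sum, hB, ← block_card A i]
      apply card_bij (fun p _ => v p)
      · intro p hp; exact (mem_filter.1 hp).2
      · intro a ha b hb hab
        apply h1.injOn _ _ hab
        · have := (mem_filter.1 ha).1; simpa using this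
        · have := (mem_filter.1 hb).1; simpa using this
      · intro x hx
        have hx' := block_sub hA hi hx
        obtain ⟨p, hp, rfl⟩ := h1.surjOn (show x ∈ Set.Icc 1 l by simpa using hx')
        exact ⟨p, by simp only [mem_filter]; exact ⟨by simpa using hp, hx⟩, rfl⟩
    · intro j hj
      rw [mat_cum hB (fun p a b => (hmap p (by simp; omega)).1) hj r le_rfl, filter_true_of_mem, block_card]
      intro p hp
      have := block_sub hB hj hp
      have := hmap p (by simp; omega)
      omega
    · obtain ⟨s, s1, s2, s3, s4⟩ := lpp_ge hB h4 h5 r le_rfl q le_rfl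
      rw [← s4]; exact h3 s s1 s2
  · rintro v v' ⟨h1, h2, h3, h4, h5⟩ ⟨g1, g2, g3, g4, g5⟩ he
    have hmap : ∀ p ∈ Icc 1 l, 1 ≤ v p ∧ v p ≤ l := by
      intro p hp
      have := h1.mapsTo (show p ∈ Set.Icc 1 l by simpa using hp)
      simpa using this
    have gmap : ∀ p ∈ Icc 1 l, 1 ≤ v' p ∧ v' p ≤ l := by
      intro p hp
      have := g1.mapsTo (show p ∈ Set.Icc 1 l by simpa using hp)
      simpa using this
    have hiff : ∀ p ∈ Icc 1 l, ∀ i ≤ r, v p ≤ off A i ↔ v' p ≤ off A i := by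
      intro p hp i hi
      have hp' := hp
      simp only [mem_Icc] at hp'
      obtain ⟨j, hj, hb⟩ := exists_block B q p (by omega) (by omega)
      have hb' : p ∈ Block B j := by rw [mem_Block]; exact hb
      rw [block_seg (h5 j hj) _ hb', block_seg (g5 j hj) _ hb',
        ← mat_cum hB (fun p a b => (hmap p (by simp; omega)).1) hj i hi,
        ← mat_cum hB (fun p a b => (gmap p (by simp; omega)).1) hj i hi, he]
    have key : ∀ p ∈ Icc 1 l, v p = v' p := by
      have im : ∀ u : ℕ → ℕ, Set.BijOn u (Set.Icc 1 l) (Set.Icc 1 l) → (Icc 1 l).image u = Icc 1 l := by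
        intro u hu
        have := hu.image_eq
        apply coe_injective
        push_cast
        exact this
      apply std_unique (l := l) (by simpa using h1.injOn) (im v h1) (by simpa using g1.injOn) (im v' g1)
      intro x hx y hy hlt
      have bx := hmap x hx
      have bY := hmap y hy
      obtain ⟨i, hi, i1, i2⟩ := exists_block A r (v y) (by omega) (by omega)
      have a1 := hiff x hx i (by omega)
      have a2 := hiff y hy i (by omega)
      have a3 := hiff x hx (i+1) (by omega)
      have a4 := hiff y hy (i+1) (by omega)
      by_cases hc : v x ≤ off A i
      · have := a1.1 hc
        have : ¬ v' y ≤ off A i := by rw [← a2]; omega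
        omega
      · have c1 : ¬ v' x ≤ off A i := by rw [← a1]; omega
        have c2 : ¬ v' y ≤ off A i := by rw [← a2]; omega
        have c3 := a3.1 (by omega)
        have c4 := a4.1 (by omega)
        apply g4 i hi x hx y hy _ (by rw [mem_Block]; omega) (by rw [mem_Block]; omega)
        by_contra hn
        rcases (not_lt.1 hn).lt_or_eq with hl | hl
        · have := h4 i hi y hy x hx hl (by rw [mem_Block]; omega) (by rw [mem_Block]; omega)
          omega
        · subst hl; omega
    funext p
    by_cases hp : p ∈ Set.Icc 1 l
    · exact key p (by simpa using hp)
    · rw [h2 p hp, g2 p hp]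
  · rintro m ⟨h0, hrow, hcol, hk⟩
    have hex : ∀ p, ∃ j, p ∈ Icc 1 l → j < q ∧ p ∈ Block B j := by
      intro p
      by_cases hp : p ∈ Icc 1 l
      · have hp' := hp
        simp only [mem_Icc] at hp'
        obtain ⟨j, hj, hb⟩ := exists_block B q p (by omega) (by omega)
        exact ⟨j, fun _ => ⟨hj, by rw [mem_Block]; exact hb⟩⟩
      · exact ⟨0, fun h => absurd h hp⟩
    choose jb hjb using hex
    have hjb' : ∀ j < q, ∀ p ∈ Block B j, jb p = j := by
      intro j hj p hp
      have := block_sub hB hj hp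
      exact block_unique (hjb p (by simp; omega)).2 hp
    let u : ℕ → ℕ → ℕ := fun i j => ∑ i' ∈ range i, m i' j
    have umono : ∀ j, ∀ i i', i ≤ i' → u i j ≤ u i' j := fun j i i' h =>
      off_mono (fun i => m i j) h
    have usucc : ∀ i j, u (i+1) j = u i j + m i j := fun i j => sum_range_succ _ _
    have uB : ∀ j < q, ∀ i ≤ r, u i j ≤ B j := by
      intro j hj i hi
      rw [← hcol j hj]; exact umono j i r hi
    let g : ℕ → ℕ := fun p => #{i ∈ range r | u (i+1) (jb p) < p - off B (jb p)}
    have hg : ∀ j < q, ∀ p ∈ Block B j, ∀ i ≤ r, g p < i ↔ p - off B j ≤ u i j := by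
      intro j hj p hp i hi
      have hj' := hjb' j hj p hp
      have hp' := hp
      rw [mem_Block] at hp'
      rcases i with _ | i
      · simp [u]; omega
      · have := mem_downset (s := {i ∈ range r | u (i+1) j < p - off B j}) (by
          intro a ha b hb
          simp only [mem_filter, mem_range] at ha ⊢
          have := umono j (b+1) (a+1) (by omega)
          omega) i
        simp only [mem_filter, mem_range] at this
        simp only [g, hj']
        omega
    obtain ⟨e, e1, e2, e3, e4⟩ := std_exists (Icc 1 l) g id (by
      intro x _ y _ _ h; exact h)
    simp only [Nat.card_Icc, Nat.add_sub_cancel] at e2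
    have hcnt : ∀ i ≤ r, #{p ∈ Icc 1 l | g p < i} = off A i := by
      intro i hi
      rw [← hB, ← blocks_sum]
      have : ∀ j ∈ range q, #{p ∈ Block B j | g p < i} = u i j := by
        intro j hj
        simp only [mem_range] at hj
        have : {p ∈ Block B j | g p < i} = Ioc (off B j) (off B j + u i j) := by
          ext p
          simp only [mem_filter, mem_Ioc]
          have h1 := uB j hj i hi
          have h2 := off_succ B j
          constructor
          · rintro ⟨a, b⟩
            rw [hg j hj p a i hi] at b
            rw [mem_Block] at a
            omega
          · intro a
            have hp : p ∈ Block B j := by rw [mem_Block]; omega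
            refine ⟨hp, ?_⟩
            rw [hg j hj p hp i hi]; omega
        rw [this, Nat.card_Ioc]; omega
      rw [sum_congr rfl this]
      simp only [u]
      rw [sum_comm]
      apply sum_congr rfl
      intro i' hi'
      exact hrow i' (by simp at hi'; omega)
    have hle : ∀ p ∈ Icc 1 l, ∀ i ≤ r, e p ≤ off A i ↔ g p < i := by
      intro x hx j hj
      rw [← hcnt j hj]; exact e4 x hx j
    let v : ℕ → ℕ := fun p => if p ∈ Icc 1 l then e p else p
    have hv : ∀ p ∈ Icc 1 l, v p = e p := fun p hp => by simp only [v]; rw [if_pos hp]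
    have hmap : ∀ p ∈ Icc 1 l, 1 ≤ e p ∧ e p ≤ l := by
      intro p hp
      have : e p ∈ Icc 1 l := by rw [← e2]; exact mem_image_of_mem _ hp
      simpa using this
    have gr : ∀ p ∈ Icc 1 l, g p < r := by
      intro p hp
      rw [← hle p hp r le_rfl, hA]; exact (hmap p hp).2
    have hmat : mat v A B r q = m := by
      funext i j
      simp only [mat]
      split_ifs with hij
      · have : {p ∈ Block B j | v p ∈ Block A i} = Ioc (off B j + u i j) (off B j + u (i+1) j) := by
          ext p
          simp only [mem_filter, mem_Ioc]
          have h1 := uB j hij.2 (i+1) hij.1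
          have h2 := off_succ B j
          have key : ∀ p ∈ Block B j, v p ∈ Block A i ↔ u i j < p - off B j ∧ p - off B j ≤ u (i+1) j := by
            intro p hp
            have hp' := block_sub hB hij.2 hp
            have hp'' : p ∈ Icc 1 l := by simp; omega
            rw [hv p hp'', mem_Block]
            have x1 := hle p hp'' i (by omega)
            have x2 := hle p hp'' (i+1) (by omega)
            rw [hg j hij.2 p hp _ (by omega)] at x1 x2
            omega
          constructor
          · rintro ⟨a, b⟩
            rw [key p a] at b
            rw [mem_Block] at a
            omega
          · intro a
            have hp : p ∈ Block B j := by rw [mem_Block]; omega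
            refine ⟨hp, ?_⟩
            rw [key p hp]; omega
        rw [this, Nat.card_Ioc, usucc]; omega
      · rw [h0 i j hij]
    refine ⟨v, ⟨?_, ?_, ?_, ?_, ?_⟩, hmat⟩
    · refine ⟨?_, ?_, ?_⟩
      · intro p hp
        have hp' : p ∈ Icc 1 l := by simpa using hp
        rw [hv p hp']
        simpa using hmap p hp'
      · intro x hx y hy hxy
        have hx' : x ∈ Icc 1 l := by simpa using hx
        have hy' : y ∈ Icc 1 l := by simpa using hy
        rw [hv x hx', hv y hy'] at hxy
        exact e1 (by exact_mod_cast hx') (by exact_mod_cast hy') hxy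
      · intro z hz
        have : z ∈ (Icc 1 l).image e := by rw [e2]; simpa using hz
        obtain ⟨p, hp, rfl⟩ := mem_image.1 this
        exact ⟨p, by simpa using hp, hv p hp⟩
    · intro p hp
      have : p ∉ Icc 1 l := by simpa using hp
      simp only [v]; rw [if_neg this]
    · intro s hs hm
      have := lpp_le (r := r) (q := q) (A := A) (B := B) (v := v) (l := l)
        (fun p hp => by rw [hv p hp]; exact (hmap p hp).1) r le_rfl q le_rfl s hs hm (fun p hp => by
          have := hs hp
          have h2 := hmap p this
          rw [hv p this]
          simp at this
          omega)
      rw [hmat] at this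
      omega
    · intro j hj x hx y hy hxy a b
      rw [hv x hx, mem_Block] at a
      rw [hv y hy, mem_Block] at b
      rw [hv x hx, hv y hy]
      have a1 := hle x hx j (by omega)
      have a2 := hle x hx (j+1) (by omega)
      have a3 := hle y hy j (by omega)
      have a4 := hle y hy (j+1) (by omega)
      exact e3 x hx y hy (Or.inr ⟨by omega, hxy⟩)
    · intro j hj x hx y hy hxy
      have sx := block_sub hB hj hx
      have sy := block_sub hB hj hy
      have hx' : x ∈ Icc 1 l := by simp; omega
      have hy' : y ∈ Icc 1 l := by simp; omega
      rw [hv x hx', hv y hy']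
      apply e3 x hx' y hy'
      have r1 := gr y hy'
      have a1 := (hg j hj y hy (g y + 1) (by omega)).1 (by omega)
      have a2 := (hg j hj x hx (g y + 1) (by omega)).2 (by omega)
      simp only [id]
      omega

def flp (l : ℕ) (w : ℕ → ℕ) : ℕ → ℕ := fun p => if p ∈ Icc 1 l then l + 1 - w p else p

lemma off_rev (A : ℕ → ℕ) (r : ℕ) : ∀ i ≤ r, off (fun i => A (r - 1 - i)) i + off A (r - i) = off A r := by
  intro i
  induction i with
  | zero => intro _; simp [off_zero]
  | succ i ih =>
    intro hi
    have h1 := ih (by omega)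
    rw [off_succ]
    obtain ⟨d, hd⟩ : ∃ d, r - (i+1) = d := ⟨_, rfl⟩
    rw [show r - i = d + 1 by omega, off_succ] at h1
    rw [hd, show r - 1 - i = d by omega]
    omega

lemma flp_apply {l : ℕ} {w : ℕ → ℕ} {p : ℕ} (hp : p ∈ Icc 1 l) : flp l w p = l + 1 - w p := by
  simp only [flp]; rw [if_pos hp]

lemma block_rev {A : ℕ → ℕ} {l r j x : ℕ} (hA : off A r = l) (hj : j < r) (hx : 1 ≤ x ∧ x ≤ l) :
    l + 1 - x ∈ Block (fun i => A (r - 1 - i)) (r - 1 - j) ↔ x ∈ Block A j := by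
  rw [mem_Block, mem_Block]
  have h1 := off_rev A r (r - 1 - j) (by omega)
  have h2 := off_rev A r (r - 1 - j + 1) (by omega)
  rw [show r - (r - 1 - j) = j + 1 by omega] at h1
  rw [show r - (r - 1 - j + 1) = j by omega] at h2
  omega

lemma flp_bij {l : ℕ} {w : ℕ → ℕ} (h : Set.BijOn w (Set.Icc 1 l) (Set.Icc 1 l)) :
    Set.BijOn (flp l w) (Set.Icc 1 l) (Set.Icc 1 l) := by
  refine ⟨?_, ?_, ?_⟩
  · intro p hp
    have := h.mapsTo hp
    rw [flp_apply (by simpa using hp)]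
    simp at this ⊢; omega
  · intro x hx y hy hxy
    have h1 := h.mapsTo hx
    have h2 := h.mapsTo hy
    rw [flp_apply (by simpa using hx), flp_apply (by simpa using hy)] at hxy
    apply h.injOn hx hy
    simp at h1 h2; omega
  · intro z hz
    obtain ⟨p, hp, hpz⟩ := h.surjOn (show l + 1 - z ∈ Set.Icc 1 l by simp at hz ⊢; omega)
    refine ⟨p, hp, ?_⟩
    rw [flp_apply (by simpa using hp), hpz]
    simp at hz; omega

lemma flp_flp {l : ℕ} {w : ℕ → ℕ} (h : Set.BijOn w (Set.Icc 1 l) (Set.Icc 1 l))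
    (h2 : ∀ m, m ∉ Set.Icc 1 l → w m = m) : flp l (flp l w) = w := by
  funext p
  by_cases hp : p ∈ Icc 1 l
  · rw [flp_apply hp, flp_apply hp]
    have := h.mapsTo (show p ∈ Set.Icc 1 l by simpa using hp)
    simp at this; omega
  · simp only [flp, if_neg hp]
    rw [h2 p (by simpa using hp)]

theorem W_card {l k r q : ℕ} {A B : ℕ → ℕ} (hA : off A r = l) (hB : off B q = l) :
    (WSet l k r q A B).ncard = (VSet l k r q (fun i => A (r - 1 - i)) B).ncard := by
  apply ncard_eq_of_invOn (flp l) (flp l)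
  · rintro w ⟨h1, h2, h3, h4, h5⟩
    have hmap : ∀ p ∈ Icc 1 l, 1 ≤ w p ∧ w p ≤ l := by
      intro p hp
      have := h1.mapsTo (show p ∈ Set.Icc 1 l by simpa using hp)
      simpa using this
    refine ⟨flp_bij h1, ?_, ?_, ?_, ?_⟩
    · intro m hm
      simp only [flp]; rw [if_neg (by simpa using hm)]
    · intro s hs hm
      by_contra hn
      obtain ⟨t, ht, htc⟩ := exists_subset_card_eq (show k + 1 ≤ #s by omega)
      have hti : ∀ i, t.orderEmbOfFin htc i ∈ s := fun i => ht (t.orderEmbOfFin_mem htc i)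
      apply h3 (t.orderEmbOfFin htc) (OrderEmbedding.strictMono _) (fun i => by simpa using hs (hti i))
      intro a b hab
      have := hm (by exact_mod_cast hti a) (by exact_mod_cast hti b) ((t.orderEmbOfFin htc).strictMono hab)
      rw [flp_apply (hs (hti a)), flp_apply (hs (hti b))] at this
      have := hmap _ (hs (hti a))
      have := hmap _ (hs (hti b))
      dsimp only
      omega
    · intro j hj x hx y hy hxy a b
      rw [flp_apply hx] at a ⊢
      rw [flp_apply hy] at b ⊢
      have mx := hmap x hx
      have my := hmap y hy
      obtain ⟨j', hj'⟩ : ∃ j', j = r - 1 - j' ∧ j' < r := ⟨r - 1 - j, by omega, by omega⟩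
      rw [hj'.1, block_rev hA hj'.2 mx] at a
      rw [hj'.1, block_rev hA hj'.2 my] at b
      by_contra hn
      rcases (show w x ≤ w y by omega).lt_or_eq with hl | hl
      · have := h4 j' hj'.2 _ a _ b hl x (by simpa using hx) y (by simpa using hy) rfl rfl
        omega
      · have := h1.injOn (by simpa using hx) (by simpa using hy) hl
        omega
    · intro j hj x hx y hy hxy
      have sx := block_sub hB hj hx
      have sy := block_sub hB hj hy
      have hx' : x ∈ Icc 1 l := by simp; omega
      have hy' : y ∈ Icc 1 l := by simp; omega
      have := h5 j hj x hx y hy hxy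
      have := hmap x hx'
      have := hmap y hy'
      rw [flp_apply hx', flp_apply hy']
      omega
  · rintro w ⟨h1, h2, h3, h4, h5⟩
    have hmap : ∀ p ∈ Icc 1 l, 1 ≤ w p ∧ w p ≤ l := by
      intro p hp
      have := h1.mapsTo (show p ∈ Set.Icc 1 l by simpa using hp)
      simpa using this
    refine ⟨flp_bij h1, ?_, ?_, ?_, ?_⟩
    · intro m hm
      simp only [flp]; rw [if_neg (by simpa using hm)]
    · intro s hs hmem hanti
      have hc : #(univ.image s) = k + 1 := by
        rw [card_image_of_injective _ hs.injective]; simp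
      have := h3 (univ.image s) (by
        intro p hp
        obtain ⟨i, _, rfl⟩ := mem_image.1 hp
        simpa using hmem i) (by
        intro x hx y hy hxy
        simp only [coe_image, coe_univ, Set.image_univ, Set.mem_range] at hx hy
        obtain ⟨i, rfl⟩ := hx
        obtain ⟨i', rfl⟩ := hy
        have hii := hanti (hs.lt_iff_lt.1 hxy)
        dsimp only at hii
        rw [flp_apply (by simpa using hmem i'), flp_apply (by simpa using hmem i)] at hii
        omega)
      omega
    · intro j hj m₁ hm₁ m₂ hm₂ hlt x hx y hy e1 e2
      have hx' : x ∈ Icc 1 l := by simpa using hx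
      have hy' : y ∈ Icc 1 l := by simpa using hy
      have mx := hmap x hx'
      have my := hmap y hy'
      rw [flp_apply hx'] at e1
      rw [flp_apply hy'] at e2
      subst e1 e2
      rw [← block_rev hA hj (by omega), show l + 1 - (l + 1 - w x) = w x by omega] at hm₁
      rw [← block_rev hA hj (by omega), show l + 1 - (l + 1 - w y) = w y by omega] at hm₂
      by_contra hn
      rcases (not_lt.1 hn).lt_or_eq with hl | hl
      · have := h4 (r - 1 - j) (by omega) x hx' y hy' hl hm₁ hm₂
        omega
      · subst hl; omega
    · intro j hj x hx y hy hxy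
      have sx := block_sub hB hj hx
      have sy := block_sub hB hj hy
      have hx' : x ∈ Icc 1 l := by simp; omega
      have hy' : y ∈ Icc 1 l := by simp; omega
      have := h5 j hj x hx y hy hxy
      have := hmap x hx'
      have := hmap y hy'
      rw [flp_apply hx', flp_apply hy']
      omega
  · rintro w ⟨h1, h2, -⟩
    exact flp_flp h1 h2
  · rintro w ⟨h1, h2, -⟩
    exact flp_flp h1 h2

end RSKAux


/-- `|S^ℓ_{A,B}| = |W^ℓ_{A,B}|`. -/
theorem card_SSet_eq_card_WSet (ℓ k r q : ℕ) (A B : ℕ → ℕ)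
    (hℓ : 1 ≤ ℓ) (hk : 1 ≤ k) (hr : 2 ≤ r) (hq : 2 ≤ q)
    (hAanti : ∀ i j, i ≤ j → j < r → A j ≤ A i)
    (hApos : ∀ i, i < r → 1 ≤ A i)
    (hAsum : ∑ i ∈ Finset.range r, A i = ℓ)
    (hBanti : ∀ i j, i ≤ j → j < q → B j ≤ B i)
    (hBpos : ∀ i, i < q → 1 ≤ B i)
    (hBsum : ∑ i ∈ Finset.range q, B i = ℓ)
    (hab : A 0 + B 0 ≤ k) :
    (SYTPairSet ℓ k r q A B).ncard = (WSet ℓ k r q A B).ncard := by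
  have hA : off A r = ℓ := hAsum
  have hB : off B q = ℓ := hBsum
  have hA' : off (fun i => A (r - 1 - i)) r = ℓ := by
    have := off_rev A r r le_rfl
    rw [Nat.sub_self, off_zero] at this
    omega
  rw [S_card (N := r + q) (by omega) (by omega) hA hB, W_card hA hB, V_card hA' hB,
    MSet_card (N := r + q) (by omega)]
  exact CSet_rev (by omega)
end
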